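/- arXiv:2202.09523 — 2 statements merged into one kernel-verified Lean document; each statement's English description precedes it below -/
import Mathlib

section
/- Let 1 < R_0 ≤ +∞, let f_1 be a meromorphic function on 𝔸(R_0), let a_1, a_2 be distinct meromorphic functions on 𝔸(R_0) (neither identically ∞) with f_1 ≢ a_1 and f_1 ≢ a_2, and set f_2 = (f_1 − a_1)/(f_1 − a_2). Then N̄_0(r, ν^0_{f_2}) + N̄_0(r, ν^0_{f_2 − 1}) + N̄_0(r, ν^∞_{f_2}) ≤ N̄_0(r, ν^∞_{f_1}) + Σ_{i=1}^{2} ( N̄_0(r, ν^0_{f_1 − a_i}) + 2·T_0(r, a_i) ) + O(1) for 1 ≤ r < R_0. -/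
open Set MeasureTheory Filter intervalIntegral
open scoped ENNReal Topology BigOperators Classical

noncomputable section

/-- The annulus `𝔸(R₀) = {z : ℂ | 1/R₀ < |z| < R₀}` for `1 < R₀ ≤ ∞`. -/
def Annulus (R0 : ℝ≥0∞) : Set ℂ :=
  {z : ℂ | R0⁻¹ < (‖z‖₊ : ℝ≥0∞) ∧ (‖z‖₊ : ℝ≥0∞) < R0}

/-- Truncation of an integer multiplicity by a level `M ∈ ℕ ∪ {∞}`. -/
def trunc (M : ℕ∞) (n : ℤ) : ℤ :=
  if M = ⊤ then n else min ((M.untopD 0 : ℕ) : ℤ) n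

/-- The (signed) local order of a meromorphic function at a point:
`divisorAt f z` is the order of vanishing of `f` at `z` (negative at poles),
with the junk value `0` if `f` is not meromorphic at `z` or `f ≡ 0` near `z`. -/
def divisorAt (f : ℂ → ℂ) (z : ℂ) : ℤ :=
  if h : MeromorphicAt f z then (meromorphicOrderAt f z).untopD 0 else 0

/-- The divisor of zeros `ν⁰_f`. -/
def zeroDiv (f : ℂ → ℂ) (z : ℂ) : ℤ := max 0 (divisorAt f z)

/-- The divisor of poles `ν^∞_f`. -/
def poleDiv (f : ℂ → ℂ) (z : ℂ) : ℤ := max 0 (-(divisorAt f z))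

/-- The unintegrated counting function `n₀^{[M]}(t)` of a divisor `ν`,
truncated at level `M`. -/
def n0 (M : ℕ∞) (ν : ℂ → ℤ) (t : ℝ) : ℝ :=
  if 1 ≤ t then ∑ᶠ z ∈ {z : ℂ | 1 ≤ ‖z‖ ∧ ‖z‖ ≤ t}, (trunc M (ν z) : ℝ)
  else ∑ᶠ z ∈ {z : ℂ | t ≤ ‖z‖ ∧ ‖z‖ < 1}, (trunc M (ν z) : ℝ)

/-- The integrated counting function `N₀^{[M]}(r, ν)` on the annulus. -/
def N0 (M : ℕ∞) (ν : ℂ → ℤ) (r : ℝ) : ℝ :=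
  (∫ t in (1/r)..1, n0 M ν t / t) + ∫ t in (1:ℝ)..r, n0 M ν t / t

/-- `log⁺ x = max 0 (log x)`. -/
def logPos (x : ℝ) : ℝ := max 0 (Real.log x)

/-- The average of `log⁺ |f|` over the circle of radius `t`. -/
def circleAvg (f : ℂ → ℂ) (t : ℝ) : ℝ :=
  (1 / (2 * Real.pi)) * ∫ θ in (0:ℝ)..(2 * Real.pi),
    logPos ‖f ((t : ℂ) * Complex.exp (θ * Complex.I))‖

/-- The proximity function `m₀(r, f)` on the annulus. -/
def m0 (f : ℂ → ℂ) (r : ℝ) : ℝ :=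
  circleAvg f r + circleAvg f (1/r) - 2 * circleAvg f 1

/-- The Nevanlinna characteristic `T₀(r, f)` on the annulus. -/
def T0 (f : ℂ → ℂ) (r : ℝ) : ℝ := m0 f r + N0 ⊤ (poleDiv f) r

/-- `S` is a small term `S_f(r)` with respect to `f` (for the parameter `λ = lam ≥ 0`):
it is `O(log (r T₀(r,f)))` (resp. `O(log (T₀(r,f)/(R₀ - r)))`) for `r` outside an
exceptional set `Δ` with `∫_Δ r^{λ-1} dr < ∞` (resp. `∫_Δ (R₀-r)^{-λ-1} dr < ∞`). -/
def IsSmallTerm (R0 : ℝ≥0∞) (lam : ℝ) (f : ℂ → ℂ) (S : ℝ → ℝ) : Prop :=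
  if R0 = ⊤ then
    ∃ (Δ : Set ℝ) (C : ℝ), Δ ⊆ Set.Ici 1 ∧
      (∫⁻ r in Δ, ENNReal.ofReal (r ^ (lam - 1))) < ⊤ ∧
      ∀ r ∈ Set.Ici (1:ℝ) \ Δ, |S r| ≤ C * (1 + |Real.log (r * T0 f r)|)
  else
    ∃ (Δ : Set ℝ) (C : ℝ), Δ ⊆ Set.Ico 1 R0.toReal ∧
      (∫⁻ r in Δ, ENNReal.ofReal ((R0.toReal - r) ^ (-(lam + 1)))) < ⊤ ∧
      ∀ r ∈ Set.Ico (1:ℝ) R0.toReal \ Δ,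
        |S r| ≤ C * (1 + |Real.log (T0 f r / (R0.toReal - r))|)

/-- A function is nonconstant on a set. -/
def NonconstantOn (f : ℂ → ℂ) (U : Set ℂ) : Prop :=
  ¬ ∃ c : ℂ, Set.EqOn f (fun _ => c) U

/-- A meromorphic function on the annulus `𝔸(R₀)` is admissible if
`limsup T₀(r,f)/log r = ∞` (when `R₀ = ∞`), resp.
`limsup T₀(r,f)/(-log (R₀ - r)) = ∞` (when `R₀ < ∞`). -/
def Admissible (R0 : ℝ≥0∞) (f : ℂ → ℂ) : Prop :=
  if R0 = ⊤ then ∀ C : ℝ, ∃ᶠ r in atTop, C < T0 f r / Real.log r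
  else ∀ C : ℝ, ∃ᶠ r in 𝓝[<] R0.toReal, C < T0 f r / (-Real.log (R0.toReal - r))

/-- `f` and `g` share the finite set `{a i}` with multiplicity truncated to level `l`. -/
def ShareTrunc (R0 : ℝ≥0∞) (l : ℕ∞) {q : ℕ} (a : Fin q → ℂ) (f g : ℂ → ℂ) : Prop :=
  ∀ z ∈ Annulus R0, (∑ i, trunc l (zeroDiv (fun w => f w - a i) z))
    = ∑ i, trunc l (zeroDiv (fun w => g w - a i) z)

/-- `P` is a uniqueness polynomial for admissible meromorphic functions on `𝔸(R₀)`. -/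
def UniquenessPolynomial (R0 : ℝ≥0∞) (P : Polynomial ℂ) : Prop :=
  ∀ f g : ℂ → ℂ, MeromorphicOn f (Annulus R0) → MeromorphicOn g (Annulus R0) →
    NonconstantOn f (Annulus R0) → NonconstantOn g (Annulus R0) →
    Admissible R0 f → Admissible R0 g →
    ∀ c : ℂ, c ≠ 0 →
      Set.EqOn (fun z => P.eval (f z)) (fun z => c * P.eval (g z)) (Annulus R0) →
      Set.EqOn f g (Annulus R0)

/-- Meromorphy of a target which is possibly `≡ ∞` (encoded by `none`). -/
def TargetMeromorphic (U : Set ℂ) : Option (ℂ → ℂ) → Prop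
  | none => True
  | some a => MeromorphicOn a U

/-- Two targets (possibly `≡ ∞`) are distinct (as meromorphic functions on `U`). -/
def TargetNe (U : Set ℂ) : Option (ℂ → ℂ) → Option (ℂ → ℂ) → Prop
  | none, none => False
  | none, some _ => True
  | some _, none => True
  | some a, some b => ¬ Set.EqOn a b U

/-- The divisor `ν⁰_{g - a}`, interpreted as `ν^∞_g` when `a ≡ ∞`. -/
def targetZeroDiv (g : ℂ → ℂ) : Option (ℂ → ℂ) → ℂ → ℤ
  | none => poleDiv g
  | some a => zeroDiv (fun z => g z - a z)

/-- The characteristic `T₀(r, a)` of a target, set to `0` when `a ≡ ∞`. -/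
def targetT0 : Option (ℂ → ℂ) → ℝ → ℝ
  | none => fun _ => 0
  | some a => T0 a

/-- A small term with respect to a target, taken `≡ 0` when the target is `≡ ∞`. -/
def TargetSmall (R0 : ℝ≥0∞) (lam : ℝ) : Option (ℂ → ℂ) → (ℝ → ℝ) → Prop
  | none => fun S => S = fun _ => 0
  | some a => IsSmallTerm R0 lam a

def cA (L : ℝ) : Set ℂ := {z | 1 / L ≤ ‖z‖ ∧ ‖z‖ ≤ L}

lemma hasDerivAt_log_norm_aux {h : ℂ → ℂ} {s θ : ℝ}
    (hh : AnalyticAt ℂ h (circleMap 0 (Real.exp s) θ))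
    (h0 : h (circleMap 0 (Real.exp s) θ) ≠ 0) :
    HasDerivAt (fun σ : ℝ => Real.log ‖h (circleMap 0 (Real.exp σ) θ)‖)
      ((circleMap 0 (Real.exp s) θ * deriv h (circleMap 0 (Real.exp s) θ)
        / h (circleMap 0 (Real.exp s) θ)).re) s := by
  set z := circleMap 0 (Real.exp s) θ with hz
  have h1 : HasDerivAt (fun σ : ℝ => circleMap 0 (Real.exp σ) θ) z s := by
    have : HasDerivAt (fun σ : ℝ => ((Real.exp σ : ℝ) : ℂ)) ((Real.exp s : ℝ) : ℂ) s :=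
      (Real.hasDerivAt_exp s).ofReal_comp
    simpa [circleMap, hz] using this.mul_const (Complex.exp (θ * Complex.I))
  have h2 : HasDerivAt (fun σ : ℝ => h (circleMap 0 (Real.exp σ) θ)) (deriv h z * z) s := by
    have := hh.differentiableAt.hasDerivAt
    exact HasDerivAt.comp s this h1
  have h3 : HasDerivAt (fun σ : ℝ => h (circleMap 0 (Real.exp σ) θ) / h z)
      (deriv h z * z / h z) s := h2.div_const _
  have h4 := h3.clog_real (by simp [← hz, div_self h0])
  have h5 := Complex.reCLM.hasFDerivAt.comp_hasDerivAt s h4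
  have h6 := h5.add_const (Real.log ‖h z‖)
  have hne : ∀ᶠ σ in 𝓝 s, h (circleMap 0 (Real.exp σ) θ) ≠ 0 :=
    h2.continuousAt.eventually_ne h0
  have h7 := h6.congr_of_eventuallyEq (f₁ := fun σ : ℝ => Real.log ‖h (circleMap 0 (Real.exp σ) θ)‖) (by
    filter_upwards [hne] with σ hσ
    have := norm_ne_zero_iff.2 hσ
    have := norm_ne_zero_iff.2 h0
    simp [Complex.log_re]
    rw [Real.log_div (by assumption) (by assumption)]; ring)
  have e : (z * deriv h z / h z).re = (deriv h z * z / h z / (h z / h z)).re := by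
    rw [div_self h0, div_one, mul_comm]
  rw [e]
  exact h7

lemma mem_cA_of_exp {r r' σ θ : ℝ} (hr : 1 ≤ r) (hrr : r < r')
    (hσ : σ ∈ Set.Icc (-Real.log r) (Real.log r)) :
    circleMap 0 (Real.exp σ) θ ∈ cA r' := by
  have hr0 : 0 < r := by linarith
  have e1 : Real.exp σ ≤ r := by
    rw [← Real.exp_log hr0]; exact Real.exp_le_exp.2 hσ.2
  have e2 : 1 / r ≤ Real.exp σ := by
    rw [one_div, ← Real.exp_log (inv_pos.2 hr0), Real.log_inv]; exact Real.exp_le_exp.2 hσ.1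
  have e3 : 1 / r' ≤ 1 / r := one_div_le_one_div_of_le hr0 hrr.le
  simp only [cA, Set.mem_ofPred_eq, norm_circleMap_zero, abs_of_pos (Real.exp_pos σ)]
  constructor <;> linarith

lemma aff {h : ℂ → ℂ} {r r' : ℝ} (hr : 1 ≤ r) (hrr : r < r')
    (hh : AnalyticOnNhd ℂ h (cA r')) (h0 : ∀ z ∈ cA r', h z ≠ 0) :
    Real.circleAverage (fun z => Real.log ‖h z‖) 0 r
      + Real.circleAverage (fun z => Real.log ‖h z‖) 0 (1 / r)
      = 2 * Real.circleAverage (fun z => Real.log ‖h z‖) 0 1 := by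
  have hr0 : 0 < r := by linarith
  set L := Real.log r with hL
  have hL0 : 0 ≤ L := Real.log_nonneg hr
  set q : ℂ → ℂ := fun z => z * deriv h z / h z with hq
  have hqa : AnalyticOnNhd ℂ q (cA r') := fun z hz =>
    (analyticAt_id.mul (hh z hz).deriv).div (hh z hz) (h0 z hz)
  -- joint continuity
  have hcm : Continuous (fun p : ℝ × ℝ => circleMap 0 (Real.exp p.1) p.2) := by
    unfold circleMap; fun_prop
  have hmaps : Set.MapsTo (fun p : ℝ × ℝ => circleMap 0 (Real.exp p.1) p.2)
      (Set.Icc (-L) L ×ˢ Set.univ) (cA r') := fun p hp => mem_cA_of_exp hr hrr hp.1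
  have hjc : ContinuousOn (fun p : ℝ × ℝ => (q (circleMap 0 (Real.exp p.1) p.2)))
      (Set.Icc (-L) L ×ˢ Set.univ) := hqa.continuousOn.comp hcm.continuousOn hmaps
  have hjre : ContinuousOn (fun p : ℝ × ℝ => (q (circleMap 0 (Real.exp p.1) p.2)).re)
      (Set.Icc (-L) L ×ˢ Set.univ) := Complex.continuous_re.comp_continuousOn hjc
  have hcθ : ∀ σ ∈ Set.Icc (-L) L, Continuous (fun θ : ℝ => (q (circleMap 0 (Real.exp σ) θ))) := by
    intro σ hσ
    have := hjc.comp_continuous (f := fun θ : ℝ => (σ, θ)) (by fun_prop) (fun θ => ⟨hσ, trivial⟩)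
    exact this
  have hGθ : ∀ σ ∈ Set.Icc (-L) L,
      Continuous (fun θ : ℝ => Real.log ‖h (circleMap 0 (Real.exp σ) θ)‖) := by
    intro σ hσ
    refine continuous_iff_continuousAt.2 fun θ => ?_
    have hm := mem_cA_of_exp (θ := θ) hr hrr hσ
    have h1 : ContinuousAt (fun θ : ℝ => h (circleMap 0 (Real.exp σ) θ)) θ :=
      ContinuousAt.comp (f := fun θ : ℝ => circleMap 0 (Real.exp σ) θ) (hh _ hm).continuousAt
        (continuous_circleMap _ _).continuousAt
    exact h1.norm.log (norm_ne_zero_iff.2 (h0 _ hm))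
  have hconst : ∀ σ ∈ Set.Icc (-L) L,
      (∫ θ in (0:ℝ)..2 * Real.pi, q (circleMap 0 (Real.exp σ) θ))
        = ∫ θ in (0:ℝ)..2 * Real.pi, q (circleMap 0 (Real.exp (-L)) θ) := by
    intro σ hσ
    have hsub : Metric.closedBall (0:ℂ) (Real.exp σ) \ Metric.ball 0 (Real.exp (-L)) ⊆ cA r' := by
      intro z hz
      simp only [Set.mem_sdiff, mem_closedBall_zero_iff, mem_ball_zero_iff, not_lt] at hz
      have e1 : Real.exp σ ≤ r := by
        rw [← Real.exp_log hr0]; exact Real.exp_le_exp.2 hσ.2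
      have e2 : 1 / r = Real.exp (-L) := by
        rw [one_div, ← Real.exp_log (inv_pos.2 hr0), Real.log_inv]
      have e3 : 1 / r' ≤ 1 / r := one_div_le_one_div_of_le hr0 hrr.le
      exact ⟨by linarith, by linarith⟩
    have key := Complex.circleIntegral_sub_center_inv_smul_eq_of_differentiable_on_annulus_off_countable
      (c := (0:ℂ)) (f := q) (s := ∅) (Real.exp_pos (-L)) (Real.exp_le_exp.2 hσ.1)
      Set.countable_empty (hqa.continuousOn.mono hsub) (fun z hz => by
        refine (hqa z (hsub ⟨Metric.ball_subset_closedBall hz.1.1, fun hh => hz.1.2 (Metric.ball_subset_closedBall hh)⟩)).differentiableAt)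
    have k1 := Real.circleAverage_eq_circleIntegral (f := q) (c := 0) (R := Real.exp σ) (Real.exp_pos _).ne'
    have k2 := Real.circleAverage_eq_circleIntegral (f := q) (c := 0) (R := Real.exp (-L)) (Real.exp_pos _).ne'
    rw [key, ← k2] at k1
    unfold Real.circleAverage at k1
    exact smul_right_injective _ (by positivity) k1
  set c : ℝ := (∫ θ in (0:ℝ)..2 * Real.pi, q (circleMap 0 (Real.exp (-L)) θ)).re with hc
  have hconst' : ∀ σ ∈ Set.Icc (-L) L,
      (∫ θ in (0:ℝ)..2 * Real.pi, (q (circleMap 0 (Real.exp σ) θ)).re) = c := by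
    intro σ hσ
    rw [hc, ← hconst σ hσ]
    exact Complex.reCLM.intervalIntegral_comp_comm ((hcθ σ hσ).intervalIntegrable _ _)
  have main : ∀ s ∈ Set.Icc (-L) L,
      (∫ θ in (0:ℝ)..2 * Real.pi, Real.log ‖h (circleMap 0 (Real.exp s) θ)‖)
       - (∫ θ in (0:ℝ)..2 * Real.pi, Real.log ‖h (circleMap 0 (Real.exp 0) θ)‖) = s * c := by
    intro s hs
    have h00 : (0:ℝ) ∈ Set.Icc (-L) L := ⟨by linarith, hL0⟩
    have hsub : Set.uIcc 0 s ⊆ Set.Icc (-L) L := Set.uIcc_subset_Icc h00 hs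
    rw [← intervalIntegral.integral_sub ((hGθ s hs).intervalIntegrable _ _)
      ((hGθ 0 h00).intervalIntegrable _ _)]
    have e1 : ∀ θ : ℝ, Real.log ‖h (circleMap 0 (Real.exp s) θ)‖
        - Real.log ‖h (circleMap 0 (Real.exp 0) θ)‖
        = ∫ σ in (0:ℝ)..s, (q (circleMap 0 (Real.exp σ) θ)).re := by
      intro θ
      symm
      refine intervalIntegral.integral_eq_sub_of_hasDerivAt
        (f := fun σ => Real.log ‖h (circleMap 0 (Real.exp σ) θ)‖) (fun σ hσ => ?_) ?_
      · have hm := mem_cA_of_exp (θ := θ) hr hrr (hsub hσ)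
        exact hasDerivAt_log_norm_aux (hh _ hm) (h0 _ hm)
      · apply ContinuousOn.intervalIntegrable
        exact hjre.comp (f := fun σ : ℝ => (σ, θ)) (by fun_prop) (fun σ hσ => ⟨hsub hσ, trivial⟩)
    simp_rw [e1]
    rw [intervalIntegral_intervalIntegral_swap]
    · rw [intervalIntegral.integral_congr (g := fun _ => c) (fun σ hσ => hconst' σ (hsub hσ))]
      simp
    · have hcomp : IsCompact (Set.uIcc (0:ℝ) (2 * Real.pi) ×ˢ Set.uIcc (0:ℝ) s) :=
        isCompact_uIcc.prod isCompact_uIcc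
      refine IntegrableOn.mono_set (ContinuousOn.integrableOn_compact hcomp ?_)
        (Set.prod_mono Set.uIoc_subset_uIcc Set.uIoc_subset_uIcc)
      exact hjre.comp (f := fun p : ℝ × ℝ => (p.2, p.1)) (by fun_prop)
        (fun p hp => ⟨hsub hp.2, trivial⟩)
  have m1 := main L ⟨by linarith, le_rfl⟩
  have m2 := main (-L) ⟨le_rfl, by linarith⟩
  have e1 : Real.exp L = r := Real.exp_log hr0
  have e2 : Real.exp (-L) = 1 / r := by rw [Real.exp_neg, e1, one_div]
  rw [e1, Real.exp_zero] at m1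
  rw [e2, Real.exp_zero] at m2
  simp only [Real.circleAverage, smul_eq_mul]
  linear_combination (2 * Real.pi)⁻¹ * (m1 + m2)

def kK (r : ℝ) (u : ℂ) : ℝ := max 0 (Real.log r - |Real.log ‖u‖|)

lemma k1int {ρ r : ℝ} (hr : 1 ≤ r) (hρ : 1 ≤ ρ) :
    IntervalIntegrable (fun t : ℝ => if ρ ≤ t then 1 / t else 0) volume 1 r ∧
    ∫ t in (1:ℝ)..r, (if ρ ≤ t then 1 / t else 0) = max 0 (Real.log r - Real.log ρ) := by
  have hb : ∀ a b : ℝ, 1 ≤ a → 1 ≤ b →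
      IntervalIntegrable (fun t : ℝ => if ρ ≤ t then 1 / t else 0) volume a b := by
    intro a b ha hb
    have h1 : IntervalIntegrable (fun t : ℝ => 1 / t) volume a b := by
      refine intervalIntegral.intervalIntegrable_one_div (fun x hx => ?_) continuousOn_id
      have := (Set.mem_uIcc.1 hx)
      have : 1 ≤ x := by rcases this with h | h <;> linarith [h.1]
      simp; linarith
    rw [intervalIntegrable_iff] at h1 ⊢
    have := h1.indicator (measurableSet_Ici (a := ρ))
    refine this.congr_fun (fun t _ => ?_) measurableSet_uIoc
    simp [Set.indicator, Set.mem_Ici]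
  have hzero : ∀ b : ℝ, 1 ≤ b → b ≤ ρ → ∫ t in (1:ℝ)..b, (if ρ ≤ t then 1 / t else 0) = 0 := by
    intro b h1 hb
    rw [intervalIntegral.integral_congr_ae (g := fun _ => (0:ℝ))]
    · simp
    · have : ∀ᵐ t : ℝ, t ≠ ρ := by simp [ae_iff, measure_singleton]
      filter_upwards [this] with t ht hm
      rw [Set.uIoc_of_le h1] at hm
      have : t < ρ := lt_of_le_of_ne (hm.2.trans hb) ht
      rw [if_neg (not_le.2 this)]
  refine ⟨hb 1 r le_rfl hr, ?_⟩
  rcases le_total r ρ with h | h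
  · rw [hzero r hr h, max_eq_left]
    linarith [Real.log_le_log (by linarith) h]
  · rw [← intervalIntegral.integral_add_adjacent_intervals (hb 1 ρ le_rfl hρ) (hb ρ r hρ hr),
      hzero ρ hρ le_rfl, zero_add, max_eq_right (by linarith [Real.log_le_log (by linarith) h])]
    rw [intervalIntegral.integral_congr (g := fun t => 1 / t)]
    · rw [integral_one_div_of_pos (by linarith) (by linarith),
        Real.log_div (by linarith) (by linarith)]
    · intro t ht
      rw [Set.uIcc_of_le h] at ht
      simp [ht.1]

lemma k2int {ρ r : ℝ} (hr : 1 ≤ r) (hρ0 : 0 < ρ) (hρ : ρ < 1) :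
    IntervalIntegrable (fun t : ℝ => if t ≤ ρ then 1 / t else 0) volume (1/r) 1 ∧
    ∫ t in (1/r)..(1:ℝ), (if t ≤ ρ then 1 / t else 0) = max 0 (Real.log r + Real.log ρ) := by
  have hr0 : 0 < 1 / r := by positivity
  have hr1 : 1 / r ≤ 1 := by rw [div_le_one (by linarith)]; exact hr
  have hlr : Real.log (1 / r) = - Real.log r := by simp
  have hb : ∀ a b : ℝ, 0 < a → 0 < b →
      IntervalIntegrable (fun t : ℝ => if t ≤ ρ then 1 / t else 0) volume a b := by
    intro a b ha hb
    have h1 : IntervalIntegrable (fun t : ℝ => 1 / t) volume a b := by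
      refine intervalIntegral.intervalIntegrable_one_div (fun x hx => ?_) continuousOn_id
      have := (Set.mem_uIcc.1 hx)
      have : 0 < x := by rcases this with h | h <;> linarith [h.1]
      simp; linarith
    rw [intervalIntegrable_iff] at h1 ⊢
    have := h1.indicator (measurableSet_Iic (a := ρ))
    refine this.congr_fun (fun t _ => ?_) measurableSet_uIoc
    simp [Set.indicator, Set.mem_Iic]
  have hzero : ∀ b : ℝ, b ≤ 1 → ρ ≤ b → ∫ t in b..(1:ℝ), (if t ≤ ρ then 1 / t else 0) = 0 := by
    intro b h1 hb
    rw [intervalIntegral.integral_congr_ae (g := fun _ => (0:ℝ))]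
    · simp
    · refine Filter.Eventually.of_forall fun t hm => ?_
      rw [Set.uIoc_of_le h1] at hm
      rw [if_neg (not_le.2 (hb.trans_lt hm.1))]
  refine ⟨hb _ _ hr0 one_pos, ?_⟩
  rcases le_total ρ (1/r) with h | h
  · rw [hzero _ hr1 h, max_eq_left]
    linarith [Real.log_le_log hρ0 h]
  · rw [← intervalIntegral.integral_add_adjacent_intervals (hb (1/r) ρ hr0 hρ0) (hb ρ 1 hρ0 one_pos),
      hzero ρ hρ.le le_rfl, add_zero, max_eq_right (by linarith [Real.log_le_log hr0 h])]
    rw [intervalIntegral.integral_congr (g := fun t => 1 / t)]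
    · rw [integral_one_div_of_pos hr0 hρ0,
        Real.log_div (by linarith) (by linarith), hlr]; ring
    · intro t ht
      rw [Set.uIcc_of_le h] at ht
      simp [ht.2]

lemma trunc_zero (M : ℕ∞) : trunc M 0 = 0 := by
  unfold trunc; split_ifs <;> simp

lemma N0_eq (M : ℕ∞) (ν : ℂ → ℤ) {r : ℝ} (hr : 1 ≤ r) (S : Finset ℂ) (hS : ∀ u ∈ S, u ∈ cA r)
    (hsupp : ∀ u ∈ cA r, ν u ≠ 0 → u ∈ S) :
    N0 M ν r = ∑ u ∈ S, (trunc M (ν u) : ℝ) * kK r u := by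
  have hr0 : 0 < 1 / r := by positivity
  have hr1 : 1 / r ≤ 1 := by rw [div_le_one (by linarith)]; exact hr
  have hfs : ∀ T : Set ℂ, T ⊆ cA r → (∑ᶠ z ∈ T, (trunc M (ν z) : ℝ))
      = ∑ u ∈ S, if u ∈ T then (trunc M (ν u) : ℝ) else 0 := by
    intro T hT
    rw [finsum_mem_def, finsum_eq_sum_of_support_subset (s := S)]
    · rfl
    · intro u hu
      simp only [Function.mem_support, Set.indicator_apply_ne_zero] at hu
      refine hsupp u (hT hu.1) fun h0 => hu.2 ?_
      simp [h0, trunc_zero]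
  have hn1 : ∀ t, 1 ≤ t → t ≤ r → n0 M ν t / t
      = ∑ u ∈ S, (trunc M (ν u) : ℝ) * (if 1 ≤ ‖u‖ then (if ‖u‖ ≤ t then 1 / t else 0) else 0) := by
    intro t h1 h2
    rw [n0, if_pos h1, hfs _ (fun z hz => ⟨hr1.trans hz.1, hz.2.trans h2⟩), Finset.sum_div]
    refine Finset.sum_congr rfl fun u _ => ?_
    simp only [Set.mem_ofPred_eq]
    by_cases a : 1 ≤ ‖u‖ <;> by_cases b : ‖u‖ ≤ t <;> simp [a, b, div_eq_mul_inv]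
  have hn2 : ∀ t, 1 / r ≤ t → t < 1 → n0 M ν t / t
      = ∑ u ∈ S, (trunc M (ν u) : ℝ) * (if ‖u‖ < 1 then (if t ≤ ‖u‖ then 1 / t else 0) else 0) := by
    intro t h1 h2
    rw [n0, if_neg (not_le.2 h2), hfs _ (fun z hz => ⟨h1.trans hz.1, hz.2.le.trans hr⟩), Finset.sum_div]
    refine Finset.sum_congr rfl fun u _ => ?_
    simp only [Set.mem_ofPred_eq]
    by_cases a : ‖u‖ < 1 <;> by_cases b : t ≤ ‖u‖ <;> simp [a, b, div_eq_mul_inv]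
  have hu0 : ∀ u ∈ S, 0 < ‖u‖ := fun u hu => hr0.trans_le (hS u hu).1
  have I1 : ∫ t in (1:ℝ)..r, n0 M ν t / t = ∑ u ∈ S, (trunc M (ν u) : ℝ) *
      (if 1 ≤ ‖u‖ then max 0 (Real.log r - Real.log ‖u‖) else 0) := by
    rw [intervalIntegral.integral_congr (g := fun t =>
      ∑ u ∈ S, (trunc M (ν u) : ℝ) * (if 1 ≤ ‖u‖ then (if ‖u‖ ≤ t then 1 / t else 0) else 0))
      (fun t ht => by
        rw [Set.uIcc_of_le hr] at ht; exact hn1 t ht.1 ht.2)]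
    rw [intervalIntegral.integral_finsetSum]
    · refine Finset.sum_congr rfl fun u _ => ?_
      rw [intervalIntegral.integral_const_mul]
      congr 1
      split_ifs with h
      · exact (k1int hr h).2
      · simp
    · intro u _
      apply IntervalIntegrable.const_mul
      split_ifs with h
      · exact (k1int hr h).1
      · simp
  have I2 : ∫ t in (1/r)..(1:ℝ), n0 M ν t / t = ∑ u ∈ S, (trunc M (ν u) : ℝ) *
      (if ‖u‖ < 1 then max 0 (Real.log r + Real.log ‖u‖) else 0) := by
    rw [intervalIntegral.integral_congr_ae (g := fun t =>
      ∑ u ∈ S, (trunc M (ν u) : ℝ) * (if ‖u‖ < 1 then (if t ≤ ‖u‖ then 1 / t else 0) else 0))]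
    · rw [intervalIntegral.integral_finsetSum]
      · refine Finset.sum_congr rfl fun u hu => ?_
        rw [intervalIntegral.integral_const_mul]
        congr 1
        split_ifs with h
        · exact (k2int hr (hu0 u hu) h).2
        · simp
      · intro u hu
        apply IntervalIntegrable.const_mul
        split_ifs with h
        · exact (k2int hr (hu0 u hu) h).1
        · simp
    · have : ∀ᵐ t : ℝ, t ≠ 1 := by simp [ae_iff, measure_singleton]
      filter_upwards [this] with t ht hm
      rw [Set.uIoc_of_le hr1] at hm
      exact hn2 t hm.1.le (lt_of_le_of_ne hm.2 ht)
  rw [N0, I1, I2, ← Finset.sum_add_distrib]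
  refine Finset.sum_congr rfl fun u hu => ?_
  rw [← mul_add, kK]
  congr 1
  by_cases h : 1 ≤ ‖u‖
  · rw [if_pos h, if_neg (not_lt.2 h), abs_of_nonneg (Real.log_nonneg h), zero_add]
  · have h' := not_le.1 h
    rw [if_neg h, if_pos h', abs_of_nonpos (Real.log_nonpos (hu0 u hu).le h'.le), add_zero,
      sub_neg_eq_add]

lemma cA_compact (L : ℝ) : IsCompact (cA L) := by
  refine (isCompact_closedBall (0:ℂ) L).of_isClosed_subset ?_ (fun z hz => by simpa using hz.2)
  exact (isClosed_le continuous_const continuous_norm).inter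
    (isClosed_le continuous_norm continuous_const)

lemma cA_preconnected {L : ℝ} (hL : 1 ≤ L) : IsPreconnected (cA L) := by
  have hL0 : 0 < L := by linarith
  have : cA L = Complex.exp '' (Complex.re ⁻¹' Set.Icc (-Real.log L) (Real.log L)) := by
    ext z
    constructor
    · intro hz
      have hz0 : 0 < ‖z‖ := lt_of_lt_of_le (by positivity) hz.1
      refine ⟨Complex.log z, ?_, Complex.exp_log (norm_pos_iff.1 hz0)⟩
      simp only [Set.mem_preimage, Complex.log_re, Set.mem_Icc]
      refine ⟨?_, Real.log_le_log hz0 hz.2⟩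
      rw [← Real.log_inv, ← one_div]
      exact Real.log_le_log (by positivity) hz.1
    · rintro ⟨w, hw, rfl⟩
      have h1 : Real.exp w.re ≤ L := by
        rw [← Real.exp_log hL0]; exact Real.exp_le_exp.2 hw.2
      have h2 : 1 / L ≤ Real.exp w.re := by
        rw [one_div, ← Real.exp_log (inv_pos.2 hL0), Real.log_inv]; exact Real.exp_le_exp.2 hw.1
      simpa [cA, Complex.norm_exp] using And.intro h2 h1
  rw [this]
  refine IsPreconnected.image ?_ _ Complex.continuous_exp.continuousOn
  exact ((convex_Icc _ _).linear_preimage Complex.reLm).isPreconnected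

lemma sphere_sub {ρ L : ℝ} (h0 : 0 < ρ) (h1 : 1 / L ≤ ρ) (h2 : ρ ≤ L) :
    Metric.sphere (0:ℂ) |ρ| ⊆ cA L := by
  intro z hz
  rw [mem_sphere_zero_iff_norm, abs_of_pos h0] at hz
  exact ⟨by rw [hz]; exact h1, by rw [hz]; exact h2⟩

lemma kK_eq {r : ℝ} (hr : 1 ≤ r) {u : ℂ} (hu : u ≠ 0) :
    Real.circleAverage (fun z => Real.log ‖z - u‖) 0 r
      + Real.circleAverage (fun z => Real.log ‖z - u‖) 0 (1 / r)
      - 2 * Real.circleAverage (fun z => Real.log ‖z - u‖) 0 1 = kK r u := by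
  have hu0 : ‖u‖ ≠ 0 := norm_ne_zero_iff.2 hu
  have key : ∀ ρ : ℝ, ρ ≠ 0 → Real.circleAverage (fun z => Real.log ‖z - u‖) 0 ρ
      = Real.log ρ + max 0 (Real.log ‖u‖ - Real.log ρ) := by
    intro ρ hρ
    rw [circleAverage_log_norm_sub_const_eq_log_radius_add_posLog hρ, Real.posLog_apply,
      zero_sub, norm_neg, Real.log_mul (inv_ne_zero hρ) hu0, Real.log_inv]
    ring_nf
  rw [key r (by linarith), key (1 / r) (by positivity), key 1 one_ne_zero, kK]
  have hL := Real.log_nonneg hr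
  rw [one_div, Real.log_inv, Real.log_one]
  generalize Real.log r = L at *
  generalize Real.log ‖u‖ = l at *
  rcases le_total 0 l with h | h <;> rcases le_total l L with h1 | h1 <;>
    rcases le_total (-L) l with h2 | h2 <;>
  grind

lemma divisorAt_eq {g : ℂ → ℂ} {z : ℂ} (h : MeromorphicAt g z) :
    divisorAt g z = (meromorphicOrderAt g z).untopD 0 := by
  simp [divisorAt, h]

lemma divisorAt_eq_divisor {g : ℂ → ℂ} {U : Set ℂ} (hg : MeromorphicOn g U) {z : ℂ} (hz : z ∈ U) :
    divisorAt g z = MeromorphicOn.divisor g U z := by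
  rw [divisorAt_eq (hg z hz), MeromorphicOn.divisor_apply hg hz]
  rfl

lemma fin_supp {g : ℂ → ℂ} {L : ℝ} (hg : MeromorphicOn g (cA L)) :
    {z | z ∈ cA L ∧ divisorAt g z ≠ 0}.Finite := by
  refine ((MeromorphicOn.divisor g (cA L)).finiteSupport (cA_compact L)).subset ?_
  rintro z ⟨hz, h⟩
  rw [divisorAt_eq_divisor hg hz] at h
  exact h

lemma kK_zero {r : ℝ} (hr : 1 ≤ r) {u : ℂ} (hu : u ≠ 0) (h : u ∉ cA r) : kK r u = 0 := by
  have hu0 : 0 < ‖u‖ := norm_pos_iff.2 hu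
  have hL := Real.log_nonneg hr
  rw [kK, max_eq_left]
  by_contra hc
  apply h
  have h1 : |Real.log ‖u‖| ≤ Real.log r := by linarith
  rw [abs_le] at h1
  constructor
  · rw [← Real.log_le_log_iff (by positivity) hu0, one_div, Real.log_inv]; exact h1.1
  · rw [← Real.log_le_log_iff hu0 (by linarith)]; exact h1.2

lemma cA_mono {r r' : ℝ} (hr : 1 ≤ r) (hrr : r ≤ r') : cA r ⊆ cA r' := fun _ hz =>
  ⟨(one_div_le_one_div_of_le (by linarith) hrr).trans hz.1, hz.2.trans hrr⟩

lemma cA_ne {r : ℝ} (hr : 1 ≤ r) {u : ℂ} (hu : u ∈ cA r) : u ≠ 0 := by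
  have : 0 < ‖u‖ := lt_of_lt_of_le (by positivity) hu.1
  exact norm_pos_iff.1 this

lemma jensen {g : ℂ → ℂ} {r r' : ℝ} (hr : 1 ≤ r) (hrr : r < r')
    (hg : MeromorphicOn g (cA r')) (ht : ∀ u ∈ cA r', meromorphicOrderAt g u ≠ ⊤) :
    Real.circleAverage (fun z => Real.log ‖g z‖) 0 r
      + Real.circleAverage (fun z => Real.log ‖g z‖) 0 (1 / r)
      - 2 * Real.circleAverage (fun z => Real.log ‖g z‖) 0 1
      = N0 ⊤ (zeroDiv g) r - N0 ⊤ (poleDiv g) r := by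
  have hr0 : 0 < r := by linarith
  have hr1 : 1 / r ≤ 1 := by rw [div_le_one (by linarith)]; exact hr
  have hr1' : 1 / r' ≤ 1 / r := one_div_le_one_div_of_le hr0 hrr.le
  set D := MeromorphicOn.divisor g (cA r') with hD
  have hfin := D.finiteSupport (cA_compact r')
  set S := hfin.toFinset with hS
  have hSm : ∀ u ∈ S, u ∈ cA r' := fun u hu => D.supportWithinDomain (by simpa [hS] using hu)
  -- counting functions
  have hN : ∀ M : ℂ → ℤ, (∀ u ∈ cA r', M u ≠ 0 → divisorAt g u ≠ 0) →
      N0 ⊤ M r = ∑ u ∈ S, (M u : ℝ) * kK r u := by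
    intro M hM
    rw [N0_eq ⊤ M hr (S.filter (· ∈ cA r)) (fun u hu => (Finset.mem_filter.1 hu).2)]
    · rw [Finset.sum_filter]
      refine Finset.sum_congr rfl fun u hu => ?_
      split_ifs with h
      · simp [trunc]
      · rw [kK_zero hr (cA_ne (hr.trans hrr.le) (hSm u hu)) h, mul_zero]
    · intro u hu h
      have hu' := cA_mono hr hrr.le hu
      have := hM u hu' h
      rw [divisorAt_eq_divisor hg hu'] at this
      rw [Finset.mem_filter]
      exact ⟨by simpa [hS] using this, hu⟩
  rw [hN (zeroDiv g) (fun u _ h h0 => h (by simp [zeroDiv, h0])),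
    hN (poleDiv g) (fun u _ h h0 => h (by simp [poleDiv, h0])), ← Finset.sum_sub_distrib]
  have e1 : ∀ u ∈ S, (zeroDiv g u : ℝ) * kK r u - (poleDiv g u : ℝ) * kK r u
      = (D u : ℝ) * kK r u := by
    intro u hu
    rw [← sub_mul]
    congr 1
    rw [hD, ← divisorAt_eq_divisor hg (hSm u hu), zeroDiv, poleDiv, ← Int.cast_sub]
    congr 1
    rcases le_total 0 (divisorAt g u) with h | h <;> grind
  rw [Finset.sum_congr rfl e1]
  obtain ⟨h, hh, h0, heq⟩ := hg.extract_zeros_poles (fun u => ht u u.2) hfin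
  have hlog := MeromorphicOn.extract_zeros_poles_log h0 heq
  have hav : ∀ ρ : ℝ, 0 < ρ → 1 / r' ≤ ρ → ρ ≤ r' →
      Real.circleAverage (fun z => Real.log ‖g z‖) 0 ρ
      = ∑ u ∈ S, (D u : ℝ) * Real.circleAverage (fun z => Real.log ‖z - u‖) 0 ρ
        + Real.circleAverage (fun z => Real.log ‖h z‖) 0 ρ := by
    intro ρ h1 h2 h3
    have hsub := sphere_sub h1 h2 h3
    have hint : ∀ u ∈ S, CircleIntegrable (fun z => (D u : ℝ) * Real.log ‖z - u‖) 0 ρ := by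
      intro u _
      apply IntervalIntegrable.const_mul
      exact circleIntegrable_log_norm_sub_const ρ
    rw [Real.circleAverage_congr_codiscreteWithin
      (Filter.codiscreteWithin_mono hsub hlog) h1.ne']
    rw [finsum_eq_sum_of_support_subset (s := S)]
    · rw [Real.circleAverage_add (CircleIntegrable.sum S hint)
        (MeromorphicOn.circleIntegrable_log_norm (fun z hz => (hh z (hsub hz)).meromorphicAt)),
        Real.circleAverage_sum hint]
      congr 1
      refine Finset.sum_congr rfl fun u _ => ?_
      simp_rw [← smul_eq_mul]
      exact Real.circleAverage_fun_smul
    · intro u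
      contrapose
      aesop
  rw [hav r hr0 (by linarith) hrr.le, hav (1/r) (by positivity) hr1' (by linarith),
    hav 1 one_pos (by linarith) (by linarith)]
  have ha := aff hr hrr hh (fun z hz => h0 ⟨z, hz⟩)
  have hk : ∑ u ∈ S, (D u : ℝ) * kK r u = ∑ u ∈ S, (D u : ℝ) * (
      Real.circleAverage (fun z => Real.log ‖z - u‖) 0 r
      + Real.circleAverage (fun z => Real.log ‖z - u‖) 0 (1 / r)
      - 2 * Real.circleAverage (fun z => Real.log ‖z - u‖) 0 1) :=
    Finset.sum_congr rfl fun u hu => by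
      rw [kK_eq hr (cA_ne (hr.trans hrr.le) (hSm u hu))]
  rw [hk]
  simp only [mul_sub, mul_add, Finset.sum_sub_distrib, Finset.sum_add_distrib]
  have : ∑ u ∈ S, (D u : ℝ) * (2 * Real.circleAverage (fun z => Real.log ‖z - u‖) 0 1)
     = 2 * ∑ u ∈ S, (D u : ℝ) * Real.circleAverage (fun z => Real.log ‖z - u‖) 0 1 := by
    rw [Finset.mul_sum]; exact Finset.sum_congr rfl fun u _ => by ring
  rw [this]
  linarith

lemma circleAvg_eq (f : ℂ → ℂ) (t : ℝ) :
    circleAvg f t = Real.circleAverage (fun z => Real.posLog ‖f z‖) 0 t := by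
  simp [circleAvg, Real.circleAverage, circleMap, logPos, Real.posLog_apply]

lemma circleAvg_nonneg (f : ℂ → ℂ) (t : ℝ) : 0 ≤ circleAvg f t := by
  rw [circleAvg_eq]
  exact Real.circleAverage_nonneg_of_nonneg fun z _ => Real.posLog_nonneg

lemma kK_nonneg (r : ℝ) (u : ℂ) : 0 ≤ kK r u := le_max_left _ _

lemma cA_sub {R0 : ℝ≥0∞} {r : ℝ} (hr : 1 ≤ r) (h : ENNReal.ofReal r < R0) :
    cA r ⊆ Annulus R0 := by
  intro z hz
  have hr0 : 0 < r := by linarith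
  have e : (‖z‖₊ : ℝ≥0∞) = ENNReal.ofReal ‖z‖ := (ofReal_norm z).symm
  constructor
  · rw [e]
    refine lt_of_lt_of_le (ENNReal.inv_lt_inv.2 h) ?_
    rw [← ENNReal.ofReal_inv_of_pos hr0, ← one_div]
    exact ENNReal.ofReal_le_ofReal hz.1
  · rw [e]
    exact lt_of_le_of_lt (ENNReal.ofReal_le_ofReal hz.2) h

lemma N0_pole_nonneg {a : ℂ → ℂ} {r : ℝ} (hr : 1 ≤ r) (ha : MeromorphicOn a (cA r)) :
    0 ≤ N0 ⊤ (poleDiv a) r := by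
  rw [N0_eq ⊤ (poleDiv a) hr (fin_supp ha).toFinset (fun u hu => by simp at hu; exact hu.1)
    (fun u hu h => by
      simp only [Set.Finite.mem_toFinset]
      exact ⟨hu, fun h0 => h (by simp [poleDiv, h0])⟩)]
  refine Finset.sum_nonneg fun u _ => mul_nonneg ?_ (kK_nonneg r u)
  simp [trunc, poleDiv]

lemma N0_pole_le (a : ℂ → ℂ) (r : ℝ) :
    N0 ⊤ (poleDiv a) r ≤ T0 a r + 2 * circleAvg a 1 := by
  have := circleAvg_nonneg a r
  have := circleAvg_nonneg a (1 / r)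
  unfold T0 m0; linarith

lemma div_nonneg_iff' {f : ℂ → ℂ} {z : ℂ} (hf : MeromorphicAt f z) :
    0 ≤ divisorAt f z ↔ 0 ≤ meromorphicOrderAt f z := by
  rw [divisorAt_eq hf]
  rcases h : meromorphicOrderAt f z with _ | n
  · exact ⟨fun _ => le_top, fun _ => le_rfl⟩
  · change 0 ≤ n ↔ ((0 : ℤ) : WithTop ℤ) ≤ (n : WithTop ℤ)
    rw [WithTop.coe_le_coe]

lemma div_ne_zero' {f : ℂ → ℂ} {z : ℂ} (hf : MeromorphicAt f z) (h : divisorAt f z ≠ 0) :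
    meromorphicOrderAt f z = (divisorAt f z : WithTop ℤ) := by
  rw [divisorAt_eq hf] at *
  rcases h' : meromorphicOrderAt f z with _ | n
  · rw [h'] at h; exact absurd rfl h
  · rfl

lemma ord_sub {f g : ℂ → ℂ} {z : ℂ} (hf : MeromorphicAt f z) (hg : MeromorphicAt g z) :
    min (meromorphicOrderAt f z) (meromorphicOrderAt g z)
      ≤ meromorphicOrderAt (fun w => f w - g w) z := by
  have h := meromorphicOrderAt_add hf hg.neg
  rw [← meromorphicOrderAt_neg (f := g)] at h
  have e : (f + -g) = fun w => f w - g w := by ext w; simp [sub_eq_add_neg]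
  rwa [e] at h

lemma div_sub_nonneg {f g : ℂ → ℂ} {z : ℂ} (hf : MeromorphicAt f z) (hg : MeromorphicAt g z)
    (h1 : 0 ≤ divisorAt f z) (h2 : 0 ≤ divisorAt g z) :
    0 ≤ divisorAt (fun w => f w - g w) z := by
  rw [div_nonneg_iff' hf] at h1
  rw [div_nonneg_iff' hg] at h2
  rw [div_nonneg_iff' (hf.fun_sub hg)]
  exact (le_min h1 h2).trans (ord_sub hf hg)

lemma pole_sub_le {f g : ℂ → ℂ} {z : ℂ} (hf : MeromorphicAt f z) (hg : MeromorphicAt g z) :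
    poleDiv (fun w => f w - g w) z ≤ poleDiv f z + poleDiv g z := by
  have h := ord_sub hf hg
  simp only [poleDiv, divisorAt_eq hf, divisorAt_eq hg, divisorAt_eq (hf.fun_sub hg)]
  generalize meromorphicOrderAt f z = a at *
  generalize meromorphicOrderAt g z = b at *
  generalize meromorphicOrderAt (fun w => f w - g w) z = c at *
  induction c using WithTop.recTopCoe with
  | top => simp; positivity
  | coe c =>
    induction a using WithTop.recTopCoe with
    | top =>
      induction b using WithTop.recTopCoe with
      | top => simp at h
      | coe b => simp at h ⊢; omega
    | coe a =>
      induction b using WithTop.recTopCoe with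
      | top => simp at h ⊢; omega
      | coe b => simp at h ⊢; omega

lemma div_of_eventually_zero {f : ℂ → ℂ} {z : ℂ} (h : ∀ᶠ w in 𝓝[≠] z, f w = 0) :
    divisorAt f z = 0 := by
  have := meromorphicOrderAt_eq_top_iff.2 h
  unfold divisorAt; rw [this]; simp

lemma div_of_eventually_const {f : ℂ → ℂ} {z : ℂ} {c : ℂ} (h : ∀ᶠ w in 𝓝[≠] z, f w = c) :
    divisorAt f z = 0 := by
  by_cases hc : c = 0
  · subst hc; exact div_of_eventually_zero h
  · unfold divisorAt
    rw [meromorphicOrderAt_congr (f₂ := fun _ => c) h, meromorphicOrderAt_const]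
    simp [hc]

lemma trunc_one (n : ℤ) : trunc 1 n = min 1 n := by
  unfold trunc
  rw [if_neg (by simp)]
  rfl

lemma min_max_one (x : ℤ) : min 1 (max 0 x) = if 0 < x then 1 else 0 := by
  split_ifs <;> omega

lemma ite_le_max (x : ℤ) : (if 0 < x then 1 else 0) ≤ max 0 x := by
  split_ifs <;> omega

lemma ite_nonneg' (x : ℤ) : (0:ℤ) ≤ if 0 < x then 1 else 0 := by
  split_ifs <;> omega

lemma arith_aux {x y dA dB dC df d1 d2 : ℤ} (n1 : 0 ≤ df → 0 ≤ d1 → 0 ≤ dA)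
    (n2 : 0 ≤ df → 0 ≤ d2 → 0 ≤ dB) (n3 : 0 ≤ d1 → 0 ≤ d2 → 0 ≤ dC)
    (key : (x = 0 ∧ y = 0) ∨ ((0 < x → y = 0) ∧ (x < 0 → y ≤ 0) ∧ x = dA - dB ∧
      (0 < y → y = dC - dB))) :
    min 1 (max 0 x) + min 1 (max 0 y) + min 1 (max 0 (-x)) ≤
      min 1 (max 0 (-df)) + min 1 (max 0 dA) + min 1 (max 0 dB) + max 0 dC + max 0 (-d1)
        + max 0 (-d2) := by
  simp only [min_max_one]
  have c := ite_le_max dC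
  have p1 := ite_le_max (-d1)
  have p2 := ite_le_max (-d2)
  have q1 := ite_nonneg' (-df)
  have q2 := ite_nonneg' dA
  have q3 := ite_nonneg' dB
  have q4 := ite_nonneg' dC
  have q5 := ite_nonneg' (-d1)
  have q6 := ite_nonneg' (-d2)
  have le1 : (if 0 < x then 1 else 0) + (if 0 < y then 1 else 0) + (if 0 < -x then 1 else 0)
      ≤ (1 : ℤ) := by
    split_ifs <;> omega
  by_cases hf : df < 0
  · rw [if_pos (by omega : 0 < -df)] at *; linarith
  by_cases h1 : d1 < 0
  · rw [if_pos (by omega : 0 < -d1)] at p1; linarith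
  by_cases h2 : d2 < 0
  · rw [if_pos (by omega : 0 < -d2)] at p2; linarith
  have hA := n1 (by omega) (by omega)
  have hB := n2 (by omega) (by omega)
  have hC := n3 (by omega) (by omega)
  by_cases hx : 0 < x
  · rw [if_pos (by omega : 0 < dA)] at *; linarith
  by_cases hx' : 0 < -x
  · rw [if_pos (by omega : 0 < dB)] at *; linarith
  by_cases hy : 0 < y
  · rw [if_pos (by omega : 0 < dC)] at *; linarith
  rw [if_neg hx, if_neg hx', if_neg hy]; linarith

lemma pointwise {f a1 a2 : ℂ → ℂ} {z : ℂ} (hf : MeromorphicAt f z) (h1 : MeromorphicAt a1 z)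
    (h2 : MeromorphicAt a2 z) :
    trunc 1 (zeroDiv (fun w => (f w - a1 w) / (f w - a2 w)) z)
      + trunc 1 (zeroDiv (fun w => (f w - a1 w) / (f w - a2 w) - 1) z)
      + trunc 1 (poleDiv (fun w => (f w - a1 w) / (f w - a2 w)) z)
    ≤ trunc 1 (poleDiv f z) + trunc 1 (zeroDiv (fun w => f w - a1 w) z)
      + trunc 1 (zeroDiv (fun w => f w - a2 w) z)
      + zeroDiv (fun w => a1 w - a2 w) z + poleDiv a1 z + poleDiv a2 z := by
  have hA := hf.fun_sub h1
  have hB := hf.fun_sub h2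
  have hC := h1.fun_sub h2
  have hF2 := hA.fun_div hB
  have hF3 := hF2.fun_sub (MeromorphicAt.const (1:ℂ) z)
  set F2 := fun w => (f w - a1 w) / (f w - a2 w) with hF2d
  set A := fun w => f w - a1 w with hAd
  set B := fun w => f w - a2 w with hBd
  set C := fun w => a1 w - a2 w with hCd
  have n1 : 0 ≤ divisorAt f z → 0 ≤ divisorAt a1 z → 0 ≤ divisorAt A z := div_sub_nonneg hf h1
  have n2 : 0 ≤ divisorAt f z → 0 ≤ divisorAt a2 z → 0 ≤ divisorAt B z := div_sub_nonneg hf h2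
  have n3 : 0 ≤ divisorAt a1 z → 0 ≤ divisorAt a2 z → 0 ≤ divisorAt C z := div_sub_nonneg h1 h2
  have key : (divisorAt F2 z = 0 ∧ divisorAt (fun w => F2 w - 1) z = 0) ∨
      ((0 < divisorAt F2 z → divisorAt (fun w => F2 w - 1) z = 0) ∧
       (divisorAt F2 z < 0 → divisorAt (fun w => F2 w - 1) z ≤ 0) ∧
       (divisorAt F2 z = divisorAt A z - divisorAt B z) ∧
       (0 < divisorAt (fun w => F2 w - 1) z →
         divisorAt (fun w => F2 w - 1) z = divisorAt C z - divisorAt B z)) := by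
    by_cases hBt : meromorphicOrderAt B z = ⊤
    · left
      rw [meromorphicOrderAt_eq_top_iff] at hBt
      constructor
      · refine div_of_eventually_zero ?_
        filter_upwards [hBt] with w hw
        simp only [hBd] at hw
        simp [hF2d, hw]
      · refine div_of_eventually_const (c := -1) ?_
        filter_upwards [hBt] with w hw
        simp only [hBd] at hw
        simp [hF2d, hw]
    by_cases hAt : meromorphicOrderAt A z = ⊤
    · left
      rw [meromorphicOrderAt_eq_top_iff] at hAt
      constructor
      · refine div_of_eventually_zero ?_
        filter_upwards [hAt] with w hw
        simp only [hAd] at hw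
        simp [hF2d, hw]
      · refine div_of_eventually_const (c := -1) ?_
        filter_upwards [hAt] with w hw
        simp only [hAd] at hw
        simp [hF2d, hw]
    right
    have hne := (meromorphicOrderAt_ne_top_iff_eventually_ne_zero hB).1 hBt
    have oF2 : meromorphicOrderAt F2 z = meromorphicOrderAt A z - meromorphicOrderAt B z :=
      meromorphicOrderAt_div hA hB
    have hC' : MeromorphicAt (fun w => -C w) z := hC.fun_neg
    have oF3 : meromorphicOrderAt (fun w => F2 w - 1) z
        = meromorphicOrderAt C z - meromorphicOrderAt B z := by
      rw [meromorphicOrderAt_fun_neg (f := C), ← meromorphicOrderAt_div hC' hB]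
      refine meromorphicOrderAt_congr ?_
      filter_upwards [hne] with w hw
      change F2 w - 1 = (-C w) / B w
      simp only [hBd] at hw
      simp only [hF2d, hBd, hCd]
      field_simp
      ring
    have hone : meromorphicOrderAt (fun _ : ℂ => (-1 : ℂ)) z = 0 := by
      rw [meromorphicOrderAt_const]; simp
    have e3 : F2 + (fun _ : ℂ => (-1 : ℂ)) = fun w => F2 w - 1 := by
      ext w; simp [sub_eq_add_neg]
    have ne3 : meromorphicOrderAt F2 z ≠ 0 → meromorphicOrderAt (fun w => F2 w - 1) z
        = min (meromorphicOrderAt F2 z) 0 := by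
      intro hh
      have := meromorphicOrderAt_add_of_ne hF2 (MeromorphicAt.const (-1:ℂ) z) (by rw [hone]; exact hh)
      rwa [e3, hone] at this
    have dF2 : divisorAt F2 z = divisorAt A z - divisorAt B z := by
      rw [divisorAt_eq hF2, divisorAt_eq hA, divisorAt_eq hB, oF2]
      lift meromorphicOrderAt A z to ℤ using hAt with x
      lift meromorphicOrderAt B z to ℤ using hBt with y
      rfl
    refine ⟨fun h => ?_, fun h => ?_, dF2, fun h => ?_⟩
    · have e := div_ne_zero' hF2 h.ne'
      rw [divisorAt_eq hF3, ne3 (by rw [e]; exact_mod_cast h.ne'), e, min_eq_right]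
      · rfl
      · exact_mod_cast h.le
    · have e := div_ne_zero' hF2 h.ne
      rw [divisorAt_eq hF3, ne3 (by rw [e]; exact_mod_cast h.ne), e, min_eq_left]
      · exact h.le
      · exact_mod_cast h.le
    · have e := div_ne_zero' hF3 h.ne'
      have hCt : meromorphicOrderAt C z ≠ ⊤ := by
        intro hCt
        rw [hCt] at oF3
        lift meromorphicOrderAt B z to ℤ using hBt with y
        rw [e] at oF3
        exact WithTop.coe_ne_top oF3
      rw [divisorAt_eq hF3, divisorAt_eq hC, divisorAt_eq hB, oF3]
      lift meromorphicOrderAt C z to ℤ using hCt with x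
      lift meromorphicOrderAt B z to ℤ using hBt with y
      rfl
  simp only [trunc_one, zeroDiv, poleDiv]
  generalize divisorAt F2 z = x at *
  generalize divisorAt (fun w => F2 w - 1) z = y at *
  generalize divisorAt A z = dA at *
  generalize divisorAt B z = dB at *
  generalize divisorAt C z = dC at *
  generalize divisorAt f z = df at *
  generalize divisorAt a1 z = d1 at *
  generalize divisorAt a2 z = d2 at *
  exact arith_aux n1 n2 n3 key

lemma zero_bound {R0 : ℝ≥0∞} (hR0 : 1 < R0) {a1 a2 : ℂ → ℂ}
    (ha1 : MeromorphicOn a1 (Annulus R0)) (ha2 : MeromorphicOn a2 (Annulus R0)) :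
    ∃ C : ℝ, ∀ r : ℝ, 1 ≤ r → ENNReal.ofReal r < R0 →
      N0 ⊤ (zeroDiv (fun z => a1 z - a2 z)) r ≤ T0 a1 r + T0 a2 r + C := by
  have hg : MeromorphicOn (fun z => a1 z - a2 z) (Annulus R0) := ha1.fun_sub ha2
  set g := fun z => a1 z - a2 z with hgd
  have one_mem : ∀ r : ℝ, 1 ≤ r → (1:ℂ) ∈ cA r := fun r hr => by
    constructor
    · rw [norm_one, div_le_one (by linarith)]; exact hr
    · rw [norm_one]; exact hr
  by_cases htop : meromorphicOrderAt g 1 = ⊤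
  · refine ⟨2 * circleAvg a1 1 + 2 * circleAvg a2 1, fun r hr hrR => ?_⟩
    have hsub := cA_sub hr hrR
    have hz : ∀ u ∈ cA r, zeroDiv g u = 0 := by
      intro u hu
      have : meromorphicOrderAt g u = ⊤ := by
        by_contra hne
        exact (hg.mono_set hsub).meromorphicOrderAt_ne_top_of_isPreconnected (cA_preconnected hr)
          hu (one_mem r hr) hne htop
      simp [zeroDiv, divisorAt, this]
    rw [N0_eq ⊤ (zeroDiv g) hr ∅ (by simp) (fun u hu h => absurd (hz u hu) h)]
    have h1 := N0_pole_nonneg hr (ha1.mono_set hsub)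
    have h2 := N0_pole_nonneg hr (ha2.mono_set hsub)
    have h3 := N0_pole_le a1 r
    have h4 := N0_pole_le a2 r
    simp only [Finset.sum_empty]
    linarith
  · refine ⟨2 * circleAvg a1 1 + 2 * circleAvg a2 1 + 2 * Real.log 2
      - 2 * Real.circleAverage (fun z => Real.log ‖g z‖) 0 1, fun r hr hrR => ?_⟩
    have hr0 : 0 < r := by linarith
    obtain ⟨r', h0, hrr, hr'R⟩ := ENNReal.lt_iff_exists_real_btwn.1 hrR
    have hrr : r < r' := (ENNReal.ofReal_lt_ofReal_iff_of_nonneg (by linarith)).1 hrr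
    have hr' : 1 ≤ r' := by linarith
    have hsub := cA_sub hr hrR
    have hsub' := cA_sub hr' hr'R
    have hJ := jensen hr hrr (hg.mono_set hsub') (fun u hu =>
      (hg.mono_set hsub').meromorphicOrderAt_ne_top_of_isPreconnected (cA_preconnected hr')
          (one_mem r' hr') hu htop)
    have hav : ∀ ρ : ℝ, 0 < ρ → 1 / r ≤ ρ → ρ ≤ r →
        Real.circleAverage (fun z => Real.log ‖g z‖) 0 ρ
          ≤ circleAvg a1 ρ + circleAvg a2 ρ + Real.log 2 := by
      intro ρ h1 h2 h3
      have hs := (sphere_sub h1 h2 h3).trans hsub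
      have i0 := (hg.mono_set hs).circleIntegrable_log_norm
      have i1 := (ha1.mono_set hs).circleIntegrable_posLog_norm
      have i2 := (ha2.mono_set hs).circleIntegrable_posLog_norm
      have i3 : CircleIntegrable (fun _ : ℂ => Real.log 2) 0 ρ := circleIntegrable_const _ _ _
      rw [circleAvg_eq, circleAvg_eq]
      have e3 : Real.circleAverage (fun _ : ℂ => Real.log 2) 0 ρ = Real.log 2 :=
        Real.circleAverage_const _ _ _
      rw [← Real.circleAverage_fun_add i1 i2]
      have e4 := Real.circleAverage_add (i1.add i2) i3
      rw [e3] at e4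
      refine le_trans (Real.circleAverage_mono i0 ((i1.add i2).add i3) fun z _ => ?_) (le_of_eq e4)
      have p1 : Real.log ‖g z‖ ≤ Real.posLog ‖g z‖ := le_max_right _ _
      have p2 := Real.posLog_norm_add_le (a1 z) (-a2 z)
      rw [norm_neg, ← sub_eq_add_neg] at p2
      have : Real.log ‖g z‖ ≤ Real.posLog ‖a1 z‖ + Real.posLog ‖a2 z‖ + Real.log 2 := by
        linarith
      exact this
    have hr1 : 1 / r ≤ 1 := by rw [div_le_one (by linarith)]; exact hr
    have v1 := hav r hr0 (by linarith) le_rfl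
    have v2 := hav (1 / r) (by positivity) le_rfl (by linarith)
    -- poles
    have hp : N0 ⊤ (poleDiv g) r ≤ N0 ⊤ (poleDiv a1) r + N0 ⊤ (poleDiv a2) r := by
      have mg := hg.mono_set hsub
      have m1 := ha1.mono_set hsub
      have m2 := ha2.mono_set hsub
      set S := (fin_supp mg).toFinset ∪ (fin_supp m1).toFinset ∪ (fin_supp m2).toFinset with hS
      have hSm : ∀ u ∈ S, u ∈ cA r := by
        intro u hu
        simp only [hS, Finset.mem_union, Set.Finite.mem_toFinset, Set.mem_ofPred_eq] at hu
        tauto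
      have hSg : ∀ u ∈ cA r, poleDiv g u ≠ 0 → u ∈ S := by
        intro u hu h
        have : divisorAt g u ≠ 0 := fun h0 => h (by simp [poleDiv, h0])
        simp only [hS, Finset.mem_union, Set.Finite.mem_toFinset, Set.mem_ofPred_eq]
        tauto
      have hS1 : ∀ u ∈ cA r, poleDiv a1 u ≠ 0 → u ∈ S := by
        intro u hu h
        have : divisorAt a1 u ≠ 0 := fun h0 => h (by simp [poleDiv, h0])
        simp only [hS, Finset.mem_union, Set.Finite.mem_toFinset, Set.mem_ofPred_eq]
        tauto
      have hS2 : ∀ u ∈ cA r, poleDiv a2 u ≠ 0 → u ∈ S := by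
        intro u hu h
        have : divisorAt a2 u ≠ 0 := fun h0 => h (by simp [poleDiv, h0])
        simp only [hS, Finset.mem_union, Set.Finite.mem_toFinset, Set.mem_ofPred_eq]
        tauto
      rw [N0_eq ⊤ _ hr S hSm hSg, N0_eq ⊤ _ hr S hSm hS1, N0_eq ⊤ _ hr S hSm hS2,
        ← Finset.sum_add_distrib]
      refine Finset.sum_le_sum fun u hu => ?_
      rw [← add_mul]
      refine mul_le_mul_of_nonneg_right ?_ (kK_nonneg r u)
      simp only [trunc, if_true]
      exact_mod_cast pole_sub_le (m1 u (hSm u hu)) (m2 u (hSm u hu))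
    unfold T0 m0
    linarith

/-- Lemma 3.1 (b): for `f₂ = (f₁ - a₁)/(f₁ - a₂)` one has
`N̄₀(r, ν⁰_{f₂}) + N̄₀(r, ν⁰_{f₂-1}) + N̄₀(r, ν^∞_{f₂})
  ≤ N̄₀(r, ν^∞_{f₁}) + ∑_{i=1,2} (N̄₀(r, ν⁰_{f₁-aᵢ}) + 2 T₀(r, aᵢ)) + O(1)`
for `1 ≤ r < R₀`. -/
theorem lemma31b
    (R0 : ℝ≥0∞) (hR0 : 1 < R0)
    (f1 a1 a2 : ℂ → ℂ)
    (hf1 : MeromorphicOn f1 (Annulus R0))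
    (ha1 : MeromorphicOn a1 (Annulus R0)) (ha2 : MeromorphicOn a2 (Annulus R0))
    (h12 : ¬ Set.EqOn a1 a2 (Annulus R0))
    (hfa1 : ¬ Set.EqOn f1 a1 (Annulus R0))
    (hfa2 : ¬ Set.EqOn f1 a2 (Annulus R0))
    (f2 : ℂ → ℂ) (hf2 : f2 = fun z => (f1 z - a1 z) / (f1 z - a2 z)) :
    ∃ C : ℝ, ∀ r : ℝ, 1 ≤ r → ENNReal.ofReal r < R0 →
      N0 1 (zeroDiv f2) r + N0 1 (zeroDiv (fun z => f2 z - 1)) r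
          + N0 1 (poleDiv f2) r ≤
        N0 1 (poleDiv f1) r
          + (N0 1 (zeroDiv (fun z => f1 z - a1 z)) r + 2 * T0 a1 r)
          + (N0 1 (zeroDiv (fun z => f1 z - a2 z)) r + 2 * T0 a2 r) + C := by
  subst hf2
  obtain ⟨C, hC⟩ := zero_bound hR0 ha1 ha2
  refine ⟨C + 2 * circleAvg a1 1 + 2 * circleAvg a2 1, fun r hr hrR => ?_⟩
  have hsub := cA_sub hr hrR
  have mf := hf1.mono_set hsub
  have m1 := ha1.mono_set hsub
  have m2 := ha2.mono_set hsub
  have mA : MeromorphicOn (fun z => f1 z - a1 z) (cA r) := mf.fun_sub m1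
  have mB : MeromorphicOn (fun z => f1 z - a2 z) (cA r) := mf.fun_sub m2
  have mC : MeromorphicOn (fun z => a1 z - a2 z) (cA r) := m1.fun_sub m2
  have mF : MeromorphicOn (fun z => (f1 z - a1 z) / (f1 z - a2 z)) (cA r) := mA.fun_div mB
  have mG : MeromorphicOn (fun z => (f1 z - a1 z) / (f1 z - a2 z) - 1) (cA r) :=
    mF.fun_sub (MeromorphicOn.const 1)
  obtain ⟨S, hSm, hS⟩ : ∃ S : Finset ℂ, (∀ u ∈ S, u ∈ cA r) ∧ ∀ u ∈ cA r,
      (divisorAt f1 u ≠ 0 ∨ divisorAt a1 u ≠ 0 ∨ divisorAt a2 u ≠ 0 ∨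
       divisorAt (fun z => f1 z - a1 z) u ≠ 0 ∨ divisorAt (fun z => f1 z - a2 z) u ≠ 0 ∨
       divisorAt (fun z => a1 z - a2 z) u ≠ 0 ∨
       divisorAt (fun z => (f1 z - a1 z) / (f1 z - a2 z)) u ≠ 0 ∨
       divisorAt (fun z => (f1 z - a1 z) / (f1 z - a2 z) - 1) u ≠ 0) → u ∈ S := by
    refine ⟨(fin_supp mf).toFinset ∪ (fin_supp m1).toFinset ∪ (fin_supp m2).toFinset ∪
      (fin_supp mA).toFinset ∪ (fin_supp mB).toFinset ∪ (fin_supp mC).toFinset ∪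
      (fin_supp mF).toFinset ∪ (fin_supp mG).toFinset, ?_, ?_⟩
    · intro u hu
      simp only [Finset.mem_union, Set.Finite.mem_toFinset, Set.mem_ofPred_eq] at hu
      tauto
    · intro u hu h
      simp only [Finset.mem_union, Set.Finite.mem_toFinset, Set.mem_ofPred_eq]
      tauto
  have zn : ∀ {g : ℂ → ℂ} {u : ℂ}, zeroDiv g u ≠ 0 → divisorAt g u ≠ 0 :=
    fun h h0 => h (by simp [zeroDiv, h0])
  have pn : ∀ {g : ℂ → ℂ} {u : ℂ}, poleDiv g u ≠ 0 → divisorAt g u ≠ 0 :=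
    fun h h0 => h (by simp [poleDiv, h0])
  have e1 := N0_eq 1 (zeroDiv (fun z => (f1 z - a1 z) / (f1 z - a2 z))) hr S hSm
    (fun u hu h => hS u hu (by have := zn h; tauto))
  have e2 := N0_eq 1 (zeroDiv (fun z => (f1 z - a1 z) / (f1 z - a2 z) - 1)) hr S hSm
    (fun u hu h => hS u hu (by have := zn h; tauto))
  have e3 := N0_eq 1 (poleDiv (fun z => (f1 z - a1 z) / (f1 z - a2 z))) hr S hSm
    (fun u hu h => hS u hu (by have := pn h; tauto))
  have e4 := N0_eq 1 (poleDiv f1) hr S hSm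
    (fun u hu h => hS u hu (by have := pn h; tauto))
  have e5 := N0_eq 1 (zeroDiv (fun z => f1 z - a1 z)) hr S hSm
    (fun u hu h => hS u hu (by have := zn h; tauto))
  have e6 := N0_eq 1 (zeroDiv (fun z => f1 z - a2 z)) hr S hSm
    (fun u hu h => hS u hu (by have := zn h; tauto))
  have e7 := N0_eq ⊤ (zeroDiv (fun z => a1 z - a2 z)) hr S hSm
    (fun u hu h => hS u hu (by have := zn h; tauto))
  have e8 := N0_eq ⊤ (poleDiv a1) hr S hSm
    (fun u hu h => hS u hu (by have := pn h; tauto))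
  have e9 := N0_eq ⊤ (poleDiv a2) hr S hSm
    (fun u hu h => hS u hu (by have := pn h; tauto))
  have main : N0 1 (zeroDiv (fun z => (f1 z - a1 z) / (f1 z - a2 z))) r
      + N0 1 (zeroDiv (fun z => (f1 z - a1 z) / (f1 z - a2 z) - 1)) r
      + N0 1 (poleDiv (fun z => (f1 z - a1 z) / (f1 z - a2 z))) r
      ≤ N0 1 (poleDiv f1) r + N0 1 (zeroDiv (fun z => f1 z - a1 z)) r
        + N0 1 (zeroDiv (fun z => f1 z - a2 z)) r
        + N0 ⊤ (zeroDiv (fun z => a1 z - a2 z)) r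
        + N0 ⊤ (poleDiv a1) r + N0 ⊤ (poleDiv a2) r := by
    rw [e1, e2, e3, e4, e5, e6, e7, e8, e9]
    simp only [← Finset.sum_add_distrib, ← add_mul]
    refine Finset.sum_le_sum fun u hu => ?_
    refine mul_le_mul_of_nonneg_right ?_ (kK_nonneg r u)
    have hp := pointwise (mf u (hSm u hu)) (m1 u (hSm u hu)) (m2 u (hSm u hu))
    have tt : ∀ n : ℤ, trunc ⊤ n = n := fun n => by simp [trunc]
    rw [tt, tt, tt]
    exact_mod_cast hp
  have c1 := hC r hr hrR
  have c2 := N0_pole_le a1 r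
  have c3 := N0_pole_le a2 r
  have main' := main
  beta_reduce at main' ⊢
  linarith

end
end

section
/- Estimate for the auxiliary gauge function δ: Let 1 < R_0 ≤ +∞ and let b_1, b_2 be meromorphic functions on 𝔸(R_0) with b_1, b_2, 0, 1 pairwise distinct. Define δ(z) = min{1, |b_1(z)|, |b_2(z)|, |b_1(z) − 1|, |b_2(z) − 1|, |b_1(z) − b_2(z)|}. Then for 1 ≤ r < R_0, Σ_{t = 1/r, r} (1/2π) ∫_0^{2π} log( 1/δ(t e^{iθ}) ) dθ ≤ 3·T_0(r, b_1) + 3·T_0(r, b_2) + S(r) + O(1), where S(r) = S_{b_1}(r) + S_{b_2}(r). -/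
open Set MeasureTheory Filter intervalIntegral
open scoped ENNReal Topology BigOperators Classical

noncomputable section

def cAnn (r : ℝ) : Set ℂ := {z : ℂ | r⁻¹ ≤ ‖z‖ ∧ ‖z‖ ≤ r}

lemma cMap_mem_cAnn {r : ℝ} (hr : 1 ≤ r) {y : ℝ} (hy : y ∈ Icc (-Real.log r) (Real.log r)) (θ : ℝ) :
    circleMap 0 (Real.exp y) θ ∈ cAnn r := by
  have h0 : 0 < r := by linarith
  have : ‖circleMap 0 (Real.exp y) θ‖ = Real.exp y := by
    rw [norm_circleMap_zero, abs_of_pos (Real.exp_pos y)]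
  refine ⟨?_, ?_⟩
  · rw [this, ← Real.exp_log (inv_pos.2 h0), Real.log_inv]
    exact Real.exp_le_exp.2 hy.1
  · rw [this]
    calc _ ≤ Real.exp (Real.log r) := Real.exp_le_exp.2 hy.2
      _ = r := Real.exp_log h0

lemma hasDerivAt_log_norm_circ (g : ℂ → ℂ) (y θ : ℝ)
    (hg : DifferentiableAt ℂ g (circleMap 0 (Real.exp y) θ))
    (hne : g (circleMap 0 (Real.exp y) θ) ≠ 0) :
    HasDerivAt (fun y : ℝ => Real.log ‖g (circleMap 0 (Real.exp y) θ)‖)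
      ((circleMap 0 (Real.exp y) θ) * (deriv g (circleMap 0 (Real.exp y) θ) /
        g (circleMap 0 (Real.exp y) θ))).re y := by
  have h1 : HasDerivAt (fun y : ℝ => circleMap 0 (Real.exp y) θ) (circleMap 0 (Real.exp y) θ) y := by
    simp only [circleMap, zero_add]
    exact ((Real.hasDerivAt_exp y).ofReal_comp).mul_const _
  have h2 := hg.hasDerivAt.comp_of_eq y h1 rfl
  have h3 := h2.norm_sq
  have h4 := (h3.log (by simpa using hne)).const_mul (1/2 : ℝ)
  refine (h4.congr_deriv ?_).congr_of_eventuallyEq (Eventually.of_forall fun x => ?_)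
  · simp only [Function.comp]
    set w := circleMap 0 (Real.exp y) θ
    have : deriv g w * w = g w * (w * (deriv g w / g w)) := by field_simp
    rw [this]
    have h5 : inner ℝ (g w) (g w * (w * (deriv g w / g w))) = ‖g w‖^2 * (w * (deriv g w / g w)).re := by
      rw [Complex.inner, mul_right_comm, Complex.mul_conj,
        Complex.re_ofReal_mul, Complex.normSq_eq_norm_sq]
    rw [h5]
    have : ‖g w‖ ≠ 0 := by simpa using hne
    field_simp
  · simp only [Function.comp, Real.log_pow]
    push_cast; ring

lemma harmonic_part (g : ℂ → ℂ) (r : ℝ) (hr : 1 ≤ r) (hg : AnalyticOnNhd ℂ g (cAnn r))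
    (hne : ∀ z ∈ cAnn r, g z ≠ 0) :
    Real.circleAverage (fun z => Real.log ‖g z‖) 0 r
      + Real.circleAverage (fun z => Real.log ‖g z‖) 0 (1/r)
      - 2 * Real.circleAverage (fun z => Real.log ‖g z‖) 0 1 = 0 := by
  have h0 : 0 < r := by linarith
  set L := Real.log r with hL
  have hL0 : 0 ≤ L := Real.log_nonneg hr
  have hsub : MapsTo (fun p : ℝ × ℝ => circleMap 0 (Real.exp p.1) p.2)
      (Icc (-L) L ×ˢ univ) (cAnn r) := fun p hp => cMap_mem_cAnn hr hp.1 p.2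
  have hcm : Continuous (fun p : ℝ × ℝ => circleMap 0 (Real.exp p.1) p.2) := by
    unfold circleMap; fun_prop
  set H : ℂ → ℂ := fun z => z * (deriv g z / g z) with hH
  have hgc : ContinuousOn g (cAnn r) := hg.continuousOn
  have hqd : AnalyticOnNhd ℂ (fun z => deriv g z / g z) (cAnn r) := hg.deriv.div hg hne
  have hHc : ContinuousOn H (cAnn r) := continuousOn_id.mul hqd.continuousOn
  have hHp : ContinuousOn (fun p : ℝ × ℝ => H (circleMap 0 (Real.exp p.1) p.2))
      (Icc (-L) L ×ˢ univ) := hHc.comp hcm.continuousOn hsub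
  have hlp : ∀ y ∈ Icc (-L) L, Continuous (fun θ : ℝ =>
      Real.log ‖g (circleMap 0 (Real.exp y) θ)‖) := by
    intro y hy
    refine Continuous.log ?_ (fun θ => by simpa using hne _ (cMap_mem_cAnn hr hy θ))
    exact (hgc.comp_continuous (continuous_circleMap 0 (Real.exp y))
      (fun θ => cMap_mem_cAnn hr hy θ)).norm
  have hHθ : ∀ y ∈ Icc (-L) L, Continuous (fun θ : ℝ => H (circleMap 0 (Real.exp y) θ)) :=
    fun y hy => hHc.comp_continuous (continuous_circleMap 0 (Real.exp y))
      (fun θ => cMap_mem_cAnn hr hy θ)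
  -- constancy
  have hconst : ∀ y ∈ Icc (-L) L, (∫ θ in (0:ℝ)..(2*Real.pi), H (circleMap 0 (Real.exp y) θ)) =
      ∫ θ in (0:ℝ)..(2*Real.pi), H (circleMap 0 (Real.exp (-L)) θ) := by
    intro y hy
    have key := Complex.circleIntegral_eq_of_differentiable_on_annulus_off_countable (c := 0)
      (r := Real.exp (-L)) (R := Real.exp y) (Real.exp_pos _) (Real.exp_le_exp.2 hy.1)
      (f := fun z => deriv g z / g z) (s := ∅) countable_empty
    have hs : Metric.closedBall (0:ℂ) (Real.exp y) \ Metric.ball 0 (Real.exp (-L)) ⊆ cAnn r := by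
      rintro z ⟨h1, h2⟩
      simp only [Metric.mem_closedBall, Metric.mem_ball, dist_zero_right, not_lt] at h1 h2
      refine ⟨?_, ?_⟩
      · rwa [Real.exp_neg, hL, Real.exp_log h0] at h2
      · refine h1.trans ?_
        calc _ ≤ Real.exp (Real.log r) := Real.exp_le_exp.2 hy.2
          _ = r := Real.exp_log h0
    have key2 := key (hqd.continuousOn.mono hs) (fun z hz => by
      refine (hqd z (hs ⟨?_, ?_⟩)).differentiableAt
      · exact Metric.ball_subset_closedBall hz.1.1
      · exact fun h => hz.1.2 (Metric.ball_subset_closedBall h))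
    have e : ∀ R : ℝ, (∮ z in C(0, R), deriv g z / g z) =
        Complex.I * ∫ θ in (0:ℝ)..(2*Real.pi), H (circleMap 0 R θ) := by
      intro R
      rw [circleIntegral, ← intervalIntegral.integral_const_mul]
      refine intervalIntegral.integral_congr fun θ _ => ?_
      simp only [deriv_circleMap, hH, smul_eq_mul]
      ring
    rw [e, e] at key2
    exact mul_left_cancel₀ Complex.I_ne_zero key2
  set K := ∫ θ in (0:ℝ)..(2*Real.pi), H (circleMap 0 (Real.exp (-L)) θ) with hK
  have hmain : ∀ x ∈ Icc (-L) L, (∫ θ in (0:ℝ)..(2*Real.pi),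
      Real.log ‖g (circleMap 0 (Real.exp x) θ)‖) -
      (∫ θ in (0:ℝ)..(2*Real.pi), Real.log ‖g (circleMap 0 (Real.exp 0) θ)‖) = x * K.re := by
    intro x hx
    have h00 : (0:ℝ) ∈ Icc (-L) L := ⟨by linarith, hL0⟩
    have hu : uIcc 0 x ⊆ Icc (-L) L := uIcc_subset_Icc h00 hx
    rw [← intervalIntegral.integral_sub ((hlp x hx).intervalIntegrable _ _)
      ((hlp 0 h00).intervalIntegrable _ _)]
    have s1 : ∀ θ : ℝ, Real.log ‖g (circleMap 0 (Real.exp x) θ)‖ -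
        Real.log ‖g (circleMap 0 (Real.exp 0) θ)‖ =
        ∫ y in (0:ℝ)..x, (H (circleMap 0 (Real.exp y) θ)).re := by
      intro θ
      symm
      refine intervalIntegral.integral_eq_sub_of_hasDerivAt
        (f := fun y : ℝ => Real.log ‖g (circleMap 0 (Real.exp y) θ)‖) (fun y hy => ?_) ?_
      · exact hasDerivAt_log_norm_circ g y θ (hg _ (cMap_mem_cAnn hr (hu hy) θ)).differentiableAt
          (hne _ (cMap_mem_cAnn hr (hu hy) θ))
      · refine ContinuousOn.intervalIntegrable ?_
        refine Complex.continuous_re.comp_continuousOn ?_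
        exact hHp.comp (f := fun y : ℝ => (y, θ)) (by fun_prop) (fun y hy => ⟨hu hy, mem_univ _⟩)
    simp_rw [s1]
    rw [intervalIntegral.integral_of_le Real.two_pi_pos.le, ← intervalIntegral_integral_swap]
    · have : ∀ y ∈ uIcc 0 x, (∫ θ in Ioc (0:ℝ) (2*Real.pi), (H (circleMap 0 (Real.exp y) θ)).re) = K.re := by
        intro y hy
        rw [← hconst y (hu hy), ← intervalIntegral.integral_of_le Real.two_pi_pos.le]
        have := Complex.reCLM.intervalIntegral_comp_comm
          ((hHθ y (hu hy)).intervalIntegrable (μ := volume) 0 (2*Real.pi))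
        simpa using this
      rw [intervalIntegral.integral_congr this]
      simp
    · rw [Measure.prod_restrict]
      have : IntegrableOn (Function.uncurry fun y θ : ℝ => (H (circleMap 0 (Real.exp y) θ)).re)
          (uIcc 0 x ×ˢ Icc 0 (2*Real.pi)) (volume.prod volume) := by
        refine ContinuousOn.integrableOn_compact (isCompact_uIcc.prod isCompact_Icc) ?_
        exact (Complex.continuous_re.comp_continuousOn hHp).mono
          (prod_mono hu (subset_univ _))
      exact this.mono_set (prod_mono uIoc_subset_uIcc Ioc_subset_Icc_self)
  have e1 := hmain L ⟨by linarith, le_rfl⟩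
  have e2 := hmain (-L) ⟨le_rfl, by linarith⟩
  rw [hL, Real.exp_log h0, Real.exp_zero] at e1
  rw [hL, Real.exp_neg, Real.exp_log h0, Real.exp_zero] at e2
  simp only [Real.circleAverage_def, smul_eq_mul, one_div]
  linear_combination (2 * Real.pi)⁻¹ * e1 + (2 * Real.pi)⁻¹ * e2

lemma int_out (a c r : ℝ) (ha : 1 ≤ a) (har : a ≤ r) :
    IntervalIntegrable (fun t : ℝ => (if a ≤ t then c else 0) / t) volume 1 r ∧
    ∫ t in (1:ℝ)..r, (if a ≤ t then c else 0) / t = c * (Real.log r - Real.log a) := by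
  have e1 : EqOn (fun _ : ℝ => (0:ℝ)) (fun t : ℝ => (if a ≤ t then c else 0) / t) (uIoo 1 a) := by
    intro t ht
    rw [uIoo_of_le ha] at ht
    simp [not_le.2 ht.2]
  have e2 : EqOn (fun t : ℝ => c * t⁻¹) (fun t : ℝ => (if a ≤ t then c else 0) / t) (uIoo a r) := by
    intro t ht
    rw [uIoo_of_le har] at ht
    simp [ht.1.le, div_eq_mul_inv]
  have i0 : IntervalIntegrable (fun t : ℝ => c * t⁻¹) volume a r := by
    refine ContinuousOn.intervalIntegrable ?_
    refine continuousOn_const.mul (continuousOn_id.inv₀ fun t ht => ?_)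
    rw [uIcc_of_le har] at ht
    exact (by linarith [ht.1] : (0:ℝ) < t).ne'
  have i1 := (intervalIntegrable_const (μ := volume) (a := 1) (b := a) (c := (0:ℝ))).congr_uIoo e1
  have i2 := i0.congr_uIoo e2
  refine ⟨i1.trans i2, ?_⟩
  rw [← intervalIntegral.integral_add_adjacent_intervals i1 i2,
    ← intervalIntegral.integral_congr_uIoo e1, ← intervalIntegral.integral_congr_uIoo e2,
    intervalIntegral.integral_const_mul, integral_inv_of_pos (by linarith) (by linarith),
    Real.log_div (by linarith) (by linarith)]
  simp

lemma int_in (a c r : ℝ) (hr : 1 ≤ r) (ha : 1 / r ≤ a) (har : a ≤ 1) :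
    IntervalIntegrable (fun t : ℝ => (if t ≤ a then c else 0) / t) volume (1/r) 1 ∧
    ∫ t in (1/r:ℝ)..1, (if t ≤ a then c else 0) / t = c * (Real.log r + Real.log a) := by
  have hp : 0 < 1 / r := by positivity
  have e1 : EqOn (fun _ : ℝ => (0:ℝ)) (fun t : ℝ => (if t ≤ a then c else 0) / t) (uIoo a 1) := by
    intro t ht
    rw [uIoo_of_le har] at ht
    simp [not_le.2 ht.1]
  have e2 : EqOn (fun t : ℝ => c * t⁻¹) (fun t : ℝ => (if t ≤ a then c else 0) / t) (uIoo (1/r) a) := by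
    intro t ht
    rw [uIoo_of_le ha] at ht
    simp [ht.2.le, div_eq_mul_inv]
  have i0 : IntervalIntegrable (fun t : ℝ => c * t⁻¹) volume (1/r) a := by
    refine ContinuousOn.intervalIntegrable ?_
    refine continuousOn_const.mul (continuousOn_id.inv₀ fun t ht => ?_)
    rw [uIcc_of_le ha] at ht
    exact (by linarith [ht.1] : (0:ℝ) < t).ne'
  have i1 := (intervalIntegrable_const (μ := volume) (a := a) (b := 1) (c := (0:ℝ))).congr_uIoo e1
  have i2 := i0.congr_uIoo e2
  refine ⟨i2.trans i1, ?_⟩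
  rw [← intervalIntegral.integral_add_adjacent_intervals i2 i1,
    ← intervalIntegral.integral_congr_uIoo e1, ← intervalIntegral.integral_congr_uIoo e2,
    intervalIntegral.integral_const_mul, integral_inv_of_pos (by linarith) (by linarith),
    Real.log_div (by linarith) (by linarith), Real.log_div (by linarith) (by linarith)]
  simp
  left; ring

lemma N0_eq_s16 (ν : ℂ → ℤ) (r : ℝ) (hr : 1 ≤ r) (F : Finset ℂ) (hF : ∀ z ∈ F, z ∈ cAnn r)
    (hs : ∀ z ∈ cAnn r, ν z ≠ 0 → z ∈ F) :
    N0 ⊤ ν r = ∑ z ∈ F, (ν z : ℝ) * (Real.log r - |Real.log ‖z‖|) := by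
  have h0 : 0 < r := by linarith
  have h1r : 1 / r ≤ 1 := by rw [div_le_one h0]; exact hr
  have a1 : EqOn (fun t => n0 ⊤ ν t / t)
      (fun t => ∑ z ∈ F, (if 1 ≤ ‖z‖ then (if ‖z‖ ≤ t then (ν z : ℝ) else 0) / t else 0))
      (uIoo 1 r) := by
    intro t ht
    rw [uIoo_of_le hr] at ht
    have : n0 ⊤ ν t = ∑ z ∈ F.filter (fun z => 1 ≤ ‖z‖ ∧ ‖z‖ ≤ t), (ν z : ℝ) := by
      simp only [n0, trunc, if_true, ht.1.le]
      apply finsum_mem_eq_sum_of_inter_support_eq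
      ext z
      simp only [mem_inter_iff, mem_ofPred_eq, Function.mem_support, Finset.coe_filter, ne_eq,
        Int.cast_eq_zero]
      constructor
      · rintro ⟨⟨p, q⟩, n⟩
        exact ⟨⟨hs z ⟨le_trans (by simpa using h1r) p, q.trans ht.2.le⟩ n, p, q⟩, n⟩
      · rintro ⟨⟨_, p, q⟩, n⟩
        exact ⟨⟨p, q⟩, n⟩
    simp only [this, Finset.sum_filter, Finset.sum_div]
    refine Finset.sum_congr rfl fun z _ => ?_
    by_cases p : 1 ≤ ‖z‖ <;> simp [p]
  have a2 : EqOn (fun t => n0 ⊤ ν t / t)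
      (fun t => ∑ z ∈ F, (if 1 ≤ ‖z‖ then 0 else (if t ≤ ‖z‖ then (ν z : ℝ) else 0) / t))
      (uIoo (1/r) 1) := by
    intro t ht
    rw [uIoo_of_le h1r] at ht
    have : n0 ⊤ ν t = ∑ z ∈ F.filter (fun z => t ≤ ‖z‖ ∧ ‖z‖ < 1), (ν z : ℝ) := by
      simp only [n0, trunc, if_true, if_neg (not_le.2 ht.2)]
      apply finsum_mem_eq_sum_of_inter_support_eq
      ext z
      simp only [mem_inter_iff, mem_ofPred_eq, Function.mem_support, Finset.coe_filter, ne_eq,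
        Int.cast_eq_zero]
      constructor
      · rintro ⟨⟨p, q⟩, n⟩
        exact ⟨⟨hs z ⟨le_trans (by simpa using ht.1.le) p, q.le.trans hr⟩ n, p, q⟩, n⟩
      · rintro ⟨⟨_, p, q⟩, n⟩
        exact ⟨⟨p, q⟩, n⟩
    simp only [this, Finset.sum_filter, Finset.sum_div]
    refine Finset.sum_congr rfl fun z _ => ?_
    by_cases p : 1 ≤ ‖z‖
    · simp [p, not_lt.2 p]
    · simp [p, not_le.1 p]
  rw [N0, intervalIntegral.integral_congr_uIoo a1, intervalIntegral.integral_congr_uIoo a2,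
    intervalIntegral.integral_finsetSum, intervalIntegral.integral_finsetSum,
    ← Finset.sum_add_distrib]
  · refine Finset.sum_congr rfl fun z hz => ?_
    obtain ⟨q1, q2⟩ := hF z hz
    by_cases p : 1 ≤ ‖z‖
    · simp only [p, if_true]
      rw [(int_out ‖z‖ (ν z) r p q2).2, abs_of_nonneg (Real.log_nonneg p)]
      simp
    · simp only [p, if_false]
      rw [(int_in ‖z‖ (ν z) r hr (by simpa using q1) (not_le.1 p).le).2,
        abs_of_nonpos (Real.log_nonpos (norm_nonneg _) (not_le.1 p).le)]
      simp
  · intro z hz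
    by_cases p : 1 ≤ ‖z‖
    · simpa only [p, if_true] using (int_out ‖z‖ (ν z) r p (hF z hz).2).1
    · simp [p]
  · intro z hz
    by_cases p : 1 ≤ ‖z‖
    · simp [p]
    · simpa only [p, if_false] using
        (int_in ‖z‖ (ν z) r hr (by simpa using (hF z hz).1) (not_le.1 p).le).1

lemma isCompact_cAnn (r : ℝ) : IsCompact (cAnn r) := by
  refine Metric.isCompact_of_isClosed_isBounded ?_ ?_
  · exact (isClosed_le continuous_const continuous_norm).inter
      (isClosed_le continuous_norm continuous_const)
  · refine (Metric.isBounded_closedBall (x := (0:ℂ)) (r := r)).subset fun z hz => ?_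
    simpa using hz.2

lemma sphere_sub_s16 {r ρ : ℝ} (hr : 1 ≤ r) (h1 : 1 / r ≤ ρ) (h2 : ρ ≤ r) :
    Metric.sphere (0:ℂ) |ρ| ⊆ cAnn r := by
  intro z hz
  have : 0 < 1 / r := by positivity
  rw [abs_of_pos (by linarith)] at hz
  simp only [mem_sphere_iff_norm, sub_zero] at hz
  exact ⟨by rw [hz]; simpa using h1, by rw [hz]; exact h2⟩

lemma jensen_s16 (h : ℂ → ℂ) (r : ℝ) (hr : 1 ≤ r) (hm : MeromorphicOn h (cAnn r))
    (ho : ∀ z ∈ cAnn r, meromorphicOrderAt h z ≠ ⊤)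
    (F : Finset ℂ) (hF : ∀ z ∈ F, z ∈ cAnn r)
    (hs : ∀ z ∈ cAnn r, divisorAt h z ≠ 0 → z ∈ F) :
    Real.circleAverage (fun z => Real.log ‖h z‖) 0 r
      + Real.circleAverage (fun z => Real.log ‖h z‖) 0 (1/r)
      - 2 * Real.circleAverage (fun z => Real.log ‖h z‖) 0 1
      = ∑ z ∈ F, (divisorAt h z : ℝ) * (Real.log r - |Real.log ‖z‖|) := by
  have h0 : 0 < r := by linarith
  have h1r : 1 / r ≤ 1 := by rw [div_le_one h0]; exact hr
  have hfin := (MeromorphicOn.divisor h (cAnn r)).finiteSupport (isCompact_cAnn r)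
  obtain ⟨g, g1, g2, g3⟩ := hm.extract_zeros_poles (fun u => ho u u.2) hfin
  have g4 := MeromorphicOn.extract_zeros_poles_log g2 g3
  have hD : ∀ z ∈ cAnn r, MeromorphicOn.divisor h (cAnn r) z = divisorAt h z := by
    intro z hz
    rw [MeromorphicOn.divisor_apply hm hz, divisorAt, dif_pos (hm z hz)]
    rfl
  have e : (∑ᶠ u, (fun x : ℂ => ((MeromorphicOn.divisor h (cAnn r) u : ℤ) : ℝ) * Real.log ‖x - u‖)) =
      ∑ u ∈ F, (fun x : ℂ => (divisorAt h u : ℝ) * Real.log ‖x - u‖) := by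
    rw [finsum_eq_sum_of_support_subset (s := F)]
    · exact Finset.sum_congr rfl fun u hu => by rw [hD u (hF u hu)]
    · intro u hu
      have hne : MeromorphicOn.divisor h (cAnn r) u ≠ 0 := by
        intro hc
        apply hu
        funext x
        simp [hc]
      have hu' : u ∈ cAnn r := by
        by_contra hc
        exact hne (Function.locallyFinsuppWithin.apply_eq_zero_of_notMem _ hc)
      exact hs u hu' (by rwa [← hD u hu'])
  rw [e] at g4
  have avg : ∀ ρ : ℝ, 1 / r ≤ ρ → ρ ≤ r → Real.circleAverage (fun z => Real.log ‖h z‖) 0 ρ =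
      (∑ u ∈ F, (divisorAt h u : ℝ) * (Real.log ρ + Real.posLog (ρ⁻¹ * ‖u‖))) +
        Real.circleAverage (fun z => Real.log ‖g z‖) 0 ρ := by
    intro ρ q1 q2
    have hρ : ρ ≠ 0 := ((by positivity : 0 < 1 / r).trans_le q1).ne'
    have ss := sphere_sub_s16 hr q1 q2
    have ci : ∀ u : ℂ, CircleIntegrable (fun x : ℂ => Real.log ‖x - u‖) 0 ρ := fun u =>
      ((analyticOnNhd_id.sub analyticOnNhd_const).meromorphicOn.circleIntegrable_log_norm)
    have ci2 : ∀ u ∈ F, CircleIntegrable (fun x : ℂ => (divisorAt h u : ℝ) * Real.log ‖x - u‖) 0 ρ :=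
      fun u _ => (ci u).const_mul _
    rw [Real.circleAverage_congr_codiscreteWithin (Filter.codiscreteWithin_mono ss g4) hρ,
      Real.circleAverage_add (CircleIntegrable.sum _ ci2)
        ((g1.mono ss).meromorphicOn.circleIntegrable_log_norm),
      Real.circleAverage_sum ci2]
    congr 1
    refine Finset.sum_congr rfl fun u _ => ?_
    have := Real.circleAverage_fun_smul (a := (divisorAt h u : ℝ)) (f := fun x : ℂ => Real.log ‖x - u‖)
      (c := 0) (R := ρ)
    simp only [smul_eq_mul] at this
    rw [this, circleAverage_log_norm_sub_const_eq_log_radius_add_posLog hρ]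
    simp
  rw [avg r (h1r.trans hr) le_rfl, avg (1/r) le_rfl (h1r.trans hr), avg 1 h1r hr]
  have hh := harmonic_part g r hr g1 (fun z hz => g2 ⟨z, hz⟩)
  have : ∑ z ∈ F, (divisorAt h z : ℝ) * (Real.log r - |Real.log ‖z‖|) =
      (∑ u ∈ F, (divisorAt h u : ℝ) * (Real.log r + Real.posLog (r⁻¹ * ‖u‖)))
      + (∑ u ∈ F, (divisorAt h u : ℝ) * (Real.log (1/r) + Real.posLog ((1/r)⁻¹ * ‖u‖)))
      - 2 * ∑ u ∈ F, (divisorAt h u : ℝ) * (Real.log 1 + Real.posLog (1⁻¹ * ‖u‖)) := by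
    rw [Finset.mul_sum, ← Finset.sum_add_distrib, ← Finset.sum_sub_distrib]
    refine Finset.sum_congr rfl fun u hu => ?_
    obtain ⟨q1, q2⟩ := hF u hu
    have hu0 : 0 < ‖u‖ := (inv_pos.2 h0).trans_le q1
    have p1 : Real.posLog (r⁻¹ * ‖u‖) = 0 := by
      rw [Real.posLog_eq_zero_iff, abs_of_nonneg (by positivity), inv_mul_le_iff₀ h0]
      simpa using q2
    have p2 : Real.posLog ((1/r)⁻¹ * ‖u‖) = Real.log r + Real.log ‖u‖ := by
      rw [Real.posLog_eq_log, one_div, inv_inv, Real.log_mul h0.ne' hu0.ne']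
      rw [one_div, inv_inv, abs_of_nonneg (by positivity)]
      rwa [inv_le_iff_one_le_mul₀' h0] at q1
    have p3 : Real.posLog (1⁻¹ * ‖u‖) = max 0 (Real.log ‖u‖) := by
      simp [Real.posLog]
    rw [p1, p2, p3]
    simp only [one_div, Real.log_inv, Real.log_one]
    rcases le_total 0 (Real.log ‖u‖) with hl | hl
    · rw [abs_of_nonneg hl, max_eq_right hl]; ring
    · rw [abs_of_nonpos hl, max_eq_left hl]; ring
  rw [this]
  linear_combination hh

lemma n0_nonneg (ν : ℂ → ℤ) (hν : ∀ z, 0 ≤ ν z) (t : ℝ) : 0 ≤ n0 ⊤ ν t := by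
  unfold n0
  split_ifs <;> refine finsum_nonneg fun z => finsum_nonneg fun _ => ?_ <;>
    simpa [trunc] using hν z

lemma N0_nonneg (ν : ℂ → ℤ) (hν : ∀ z, 0 ≤ ν z) (r : ℝ) (hr : 1 ≤ r) : 0 ≤ N0 ⊤ ν r := by
  have h0 : 0 < r := by linarith
  have h1r : 1 / r ≤ 1 := by rw [div_le_one h0]; exact hr
  have hp : 0 < 1 / r := by positivity
  unfold N0
  refine add_nonneg (intervalIntegral.integral_nonneg h1r fun t ht => ?_)
    (intervalIntegral.integral_nonneg hr fun t ht => ?_)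
  · exact div_nonneg (n0_nonneg ν hν t) (hp.le.trans ht.1)
  · exact div_nonneg (n0_nonneg ν hν t) (zero_le_one.trans ht.1)

lemma T0_lower (f : ℂ → ℂ) (r : ℝ) (hr : 1 ≤ r) : - (2 * circleAvg f 1) ≤ T0 f r := by
  have := N0_nonneg (poleDiv f) (fun z => le_max_left _ _) r hr
  have h1 := circleAvg_nonneg f r
  have h2 := circleAvg_nonneg f (1/r)
  unfold T0 m0
  linarith

lemma divSupp_finite (f : ℂ → ℂ) (r : ℝ) (hm : MeromorphicOn f (cAnn r)) :
    {z ∈ cAnn r | divisorAt f z ≠ 0}.Finite := by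
  refine ((MeromorphicOn.divisor f (cAnn r)).finiteSupport (isCompact_cAnn r)).subset ?_
  rintro z ⟨hz, hn⟩
  rw [divisorAt, dif_pos (hm z hz)] at hn
  rw [Function.mem_support, MeromorphicOn.divisor_apply hm hz]
  exact hn

lemma poleDiv_sub_le (f g : ℂ → ℂ) (z : ℂ) (hf : MeromorphicAt f z) (hg : MeromorphicAt g z) :
    poleDiv (fun w => f w - g w) z ≤ poleDiv f z + poleDiv g z := by
  have hfg : MeromorphicAt (fun w => f w - g w) z := hf.sub hg
  have h1 := meromorphicOrderAt_add hf hg.neg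
  rw [← sub_eq_add_neg, ← meromorphicOrderAt_neg] at h1
  change _ ≤ meromorphicOrderAt (fun w => f w - g w) z at h1
  unfold poleDiv divisorAt
  rw [dif_pos hf, dif_pos hg, dif_pos hfg]
  generalize meromorphicOrderAt (fun w => f w - g w) z = c at *
  generalize meromorphicOrderAt f z = a at *
  generalize meromorphicOrderAt g z = b at *
  cases c with
  | top => simp; positivity
  | coe c =>
    cases a with
    | top =>
      cases b with
      | top => simp at h1
      | coe b =>
        simp at h1 ⊢
        omega
    | coe a =>
      cases b with
      | top =>
        simp at h1 ⊢
        omega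
      | coe b =>
        simp at h1
        norm_cast at h1
        simp
        omega

lemma prox_bound (f g : ℂ → ℂ) (r : ℝ) (hr : 1 ≤ r) (hf : MeromorphicOn f (cAnn r))
    (hg : MeromorphicOn g (cAnn r))
    (ho : ∀ z ∈ cAnn r, meromorphicOrderAt (fun w => f w - g w) z ≠ ⊤) :
    circleAvg (fun w => (f w - g w)⁻¹) r + circleAvg (fun w => (f w - g w)⁻¹) (1/r) ≤
      T0 f r + T0 g r + (2 * circleAvg f 1 + 2 * circleAvg g 1 + 2 * Real.log 2
        - 2 * circleAvg (fun w => f w - g w) 1 + 2 * circleAvg (fun w => (f w - g w)⁻¹) 1) := by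
  have h0 : 0 < r := by linarith
  have h1r : 1 / r ≤ 1 := by rw [div_le_one h0]; exact hr
  set h : ℂ → ℂ := fun w => f w - g w with hh
  have hm : MeromorphicOn h (cAnn r) := hf.sub hg
  set F : Finset ℂ := (divSupp_finite f r hf).toFinset ∪ (divSupp_finite g r hg).toFinset
    ∪ (divSupp_finite h r hm).toFinset with hFdef
  have hF : ∀ z ∈ F, z ∈ cAnn r := by
    intro z hz
    simp only [hFdef, Finset.mem_union, Set.Finite.mem_toFinset] at hz
    rcases hz with (hz | hz) | hz <;> exact hz.1
  have sf : ∀ z ∈ cAnn r, divisorAt f z ≠ 0 → z ∈ F := fun z hz hn => by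
    simp only [hFdef, Finset.mem_union, Set.Finite.mem_toFinset]
    exact Or.inl (Or.inl ⟨hz, hn⟩)
  have sg : ∀ z ∈ cAnn r, divisorAt g z ≠ 0 → z ∈ F := fun z hz hn => by
    simp only [hFdef, Finset.mem_union, Set.Finite.mem_toFinset]
    exact Or.inl (Or.inr ⟨hz, hn⟩)
  have sh : ∀ z ∈ cAnn r, divisorAt h z ≠ 0 → z ∈ F := fun z hz hn => by
    simp only [hFdef, Finset.mem_union, Set.Finite.mem_toFinset]
    exact Or.inr ⟨hz, hn⟩
  have pn : ∀ (k : ℂ → ℂ) (z : ℂ), poleDiv k z ≠ 0 → divisorAt k z ≠ 0 := by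
    intro k z hk hc; apply hk; simp [poleDiv, hc]
  have w0 : ∀ z ∈ F, 0 ≤ Real.log r - |Real.log ‖z‖| := by
    intro z hz
    obtain ⟨q1, q2⟩ := hF z hz
    have hz0 : 0 < ‖z‖ := (inv_pos.2 h0).trans_le q1
    rw [sub_nonneg, abs_le, ← Real.log_inv]
    exact ⟨Real.log_le_log (inv_pos.2 h0) q1, Real.log_le_log hz0 q2⟩
  have Nf := N0_eq_s16 (poleDiv f) r hr F hF (fun z hz hn => sf z hz (pn f z hn))
  have Ng := N0_eq_s16 (poleDiv g) r hr F hF (fun z hz hn => sg z hz (pn g z hn))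
  have J := jensen_s16 h r hr hm ho F hF sh
  have JN : ∑ z ∈ F, (divisorAt h z : ℝ) * (Real.log r - |Real.log ‖z‖|) ≥
      - (N0 ⊤ (poleDiv f) r + N0 ⊤ (poleDiv g) r) := by
    rw [Nf, Ng, ← Finset.sum_add_distrib, ← Finset.sum_neg_distrib]
    refine Finset.sum_le_sum fun z hz => ?_
    rw [← add_mul, ← neg_mul]
    refine mul_le_mul_of_nonneg_right ?_ (w0 z hz)
    have p := poleDiv_sub_le f g z (hf z (hF z hz)) (hg z (hF z hz))
    have p2 : -(divisorAt h z) ≤ poleDiv h z := le_max_right _ _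
    have : -(poleDiv f z + poleDiv g z) ≤ divisorAt h z := by linarith
    exact_mod_cast this
  have ci : ∀ (k : ℂ → ℂ), MeromorphicOn k (cAnn r) → ∀ ρ : ℝ, 1 / r ≤ ρ → ρ ≤ r →
      CircleIntegrable (fun z => Real.posLog ‖k z‖) 0 ρ := fun k hk ρ q1 q2 =>
    (hk.mono_set (sphere_sub_s16 hr q1 q2)).circleIntegrable_posLog_norm
  have U : ∀ ρ : ℝ, 1 / r ≤ ρ → ρ ≤ r → Real.circleAverage (fun z => Real.log ‖h z‖) 0 ρ =
      circleAvg h ρ - circleAvg (fun w => (h w)⁻¹) ρ := by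
    intro ρ q1 q2
    rw [circleAvg_eq, circleAvg_eq, ← Real.circleAverage_fun_sub (ci h hm ρ q1 q2)
      (ci (fun w => (h w)⁻¹) hm.inv ρ q1 q2)]
    congr 1
    funext z
    rw [norm_inv, Real.posLog_sub_posLog_inv]
  have M : ∀ ρ : ℝ, 1 / r ≤ ρ → ρ ≤ r → circleAvg h ρ ≤ circleAvg f ρ + circleAvg g ρ + Real.log 2 := by
    intro ρ q1 q2
    have c1 := ci f hf ρ q1 q2
    have c2 := ci g hg ρ q1 q2
    have c12 : CircleIntegrable (fun z => Real.posLog ‖f z‖ + Real.posLog ‖g z‖) 0 ρ := c1.add c2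
    have c3 : CircleIntegrable (fun _ : ℂ => Real.log 2) 0 ρ := circleIntegrable_const _ _ _
    rw [circleAvg_eq, circleAvg_eq, circleAvg_eq, ← Real.circleAverage_fun_add c1 c2,
      ← Real.circleAverage_const (Real.log 2) 0 ρ, ← Real.circleAverage_fun_add c12 c3]
    refine Real.circleAverage_mono (ci h hm ρ q1 q2) (c12.add c3) fun z _ => ?_
    have := Real.posLog_norm_add_le (f z) (-(g z))
    rw [norm_neg, ← sub_eq_add_neg] at this
    exact this
  rw [U r (h1r.trans hr) le_rfl, U (1/r) le_rfl (h1r.trans hr), U 1 h1r hr] at J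
  have M1 := M r (h1r.trans hr) le_rfl
  have M2 := M (1/r) le_rfl (h1r.trans hr)
  unfold T0 m0
  linarith

lemma T0_const (c : ℂ) (hc : ‖c‖ ≤ 1) (r : ℝ) (hr : 1 ≤ r) : T0 (fun _ => c) r = 0 := by
  have h1 : ∀ t, circleAvg (fun _ => c) t = 0 := by
    intro t
    have : logPos ‖c‖ = 0 := max_eq_left (Real.log_nonpos (norm_nonneg _) hc)
    simp [circleAvg, this]
  have h2 : ∀ z, poleDiv (fun _ => c) z = 0 := by
    intro z
    have : 0 ≤ divisorAt (fun _ : ℂ => c) z := by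
      unfold divisorAt
      rw [dif_pos (MeromorphicAt.const c z)]
      by_cases h : c = 0
      · simp [h, meromorphicOrderAt_const]
      · simp [h, meromorphicOrderAt_const]
    unfold poleDiv
    omega
  have h3 := N0_eq_s16 (poleDiv fun _ => c) r hr ∅ (by simp) (fun z _ h => absurd (h2 z) h)
  unfold T0 m0
  rw [h1, h1, h1, h3]; simp

lemma isPreconnected_Annulus (R0 : ℝ≥0∞) : IsPreconnected (Annulus R0) := by
  have e : Annulus R0 = Complex.exp '' (Complex.reLm ⁻¹'
      {x : ℝ | R0⁻¹ < ENNReal.ofReal (Real.exp x) ∧ ENNReal.ofReal (Real.exp x) < R0}) := by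
    have hn : ∀ w : ℂ, (‖Complex.exp w‖₊ : ℝ≥0∞) = ENNReal.ofReal (Real.exp w.re) := by
      intro w
      rw [← Complex.norm_exp, ofReal_norm]; rfl
    ext z
    constructor
    · intro hz
      have hz0 : z ≠ 0 := by
        rintro rfl
        have := hz.1
        simp at this
      refine ⟨Complex.log z, ?_, Complex.exp_log hz0⟩
      have h1 := hn (Complex.log z)
      rw [Complex.exp_log hz0] at h1
      simp only [mem_preimage, mem_ofPred_eq, Complex.reLm_coe, ← h1]
      exact hz
    · rintro ⟨w, hw, rfl⟩
      simp only [Annulus, mem_ofPred_eq, hn]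
      exact hw
  rw [e]
  refine IsPreconnected.image ?_ _ Complex.continuous_exp.continuousOn
  refine Convex.isPreconnected ?_
  refine Convex.linear_preimage ?_ _
  refine Set.OrdConnected.convex ⟨fun x hx y hy t ht => ⟨?_, ?_⟩⟩
  · exact hx.1.trans_le (ENNReal.ofReal_le_ofReal (Real.exp_le_exp.2 ht.1))
  · exact (ENNReal.ofReal_le_ofReal (Real.exp_le_exp.2 ht.2)).trans_lt hy.2

lemma cAnn_sub (R0 : ℝ≥0∞) (r : ℝ) (hr : 1 ≤ r) (h : ENNReal.ofReal r < R0) :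
    cAnn r ⊆ Annulus R0 := by
  rintro z ⟨h1, h2⟩
  have h0 : 0 < r := by linarith
  have e : (‖z‖₊ : ℝ≥0∞) = ENNReal.ofReal ‖z‖ := by rw [ofReal_norm]; rfl
  refine ⟨?_, ?_⟩
  · rw [e]
    refine lt_of_lt_of_le ?_ (ENNReal.ofReal_le_ofReal h1)
    rw [ENNReal.ofReal_inv_of_pos h0]
    exact ENNReal.inv_lt_inv.2 h
  · rw [e]
    exact (ENNReal.ofReal_le_ofReal h2).trans_lt h

lemma isSmall_zero (R0 : ℝ≥0∞) (lam : ℝ) (f : ℂ → ℂ) : IsSmallTerm R0 lam f (fun _ => 0) := by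
  unfold IsSmallTerm
  split_ifs
  · exact ⟨∅, 0, by simp, by simp, by simp⟩
  · exact ⟨∅, 0, by simp, by simp, by simp⟩

lemma degenerate (h : ℂ → ℂ) (δ : ℂ → ℝ) (hδ : ∀ z, h z = 0 → δ z = 0) (ρ : ℝ) (hρ : ρ ≠ 0)
    (ho : ∀ z ∈ Metric.sphere (0:ℂ) |ρ|, meromorphicOrderAt h z = ⊤) :
    Real.circleAverage (fun z => Real.log (1 / δ z)) 0 ρ = 0 := by
  have : (fun z => Real.log (1 / δ z)) =ᶠ[codiscreteWithin (Metric.sphere (0:ℂ) |ρ|)]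
      (fun _ => (0:ℝ)) := by
    rw [Filter.EventuallyEq, Filter.Eventually, mem_codiscreteWithin]
    intro x hx
    rw [Filter.disjoint_principal_right]
    filter_upwards [meromorphicOrderAt_eq_top_iff.1 (ho x hx)] with z hz
    simp [hδ z hz]
  rw [Real.circleAverage_congr_codiscreteWithin this hρ, Real.circleAverage_const]

/-- the dichotomy -/
lemma order_dichotomy (R0 : ℝ≥0∞) (h : ℂ → ℂ) (hm : MeromorphicOn h (Annulus R0)) :
    (∀ z ∈ Annulus R0, meromorphicOrderAt h z ≠ ⊤) ∨
    (∀ z ∈ Annulus R0, meromorphicOrderAt h z = ⊤) := by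
  by_contra hc
  push Not at hc
  obtain ⟨⟨x, hx, hx'⟩, y, hy, hy'⟩ := hc
  exact hm.meromorphicOrderAt_ne_top_of_isPreconnected (isPreconnected_Annulus R0) hy hx hy' hx'

lemma log_inv_le {d a : ℝ} (hd : d = a) : Real.log (1 / d) ≤ Real.posLog a⁻¹ := by
  rw [hd, one_div]; exact le_max_right _ _

lemma delta_pointwise (a b c d e : ℝ) :
    Real.log (1 / min 1 (min a (min b (min c (min d e))))) ≤
      Real.posLog a⁻¹ + Real.posLog b⁻¹ + Real.posLog c⁻¹ + Real.posLog d⁻¹ + Real.posLog e⁻¹ := by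
  have n : ∀ x : ℝ, 0 ≤ Real.posLog x := fun x => Real.posLog_nonneg
  have := n a⁻¹; have := n b⁻¹; have := n c⁻¹; have := n d⁻¹; have := n e⁻¹
  rcases min_choice 1 (min a (min b (min c (min d e)))) with h | h
  · rw [h]; simp; linarith
  rw [h]
  rcases min_choice a (min b (min c (min d e))) with h | h
  · linarith [log_inv_le h]
  rw [h]
  rcases min_choice b (min c (min d e)) with h | h
  · linarith [log_inv_le h]
  rw [h]
  rcases min_choice c (min d e) with h | h
  · linarith [log_inv_le h]
  rw [h]
  rcases min_choice d e with h | h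
  · linarith [log_inv_le h]
  · linarith [log_inv_le h]

lemma avg_form (δ : ℂ → ℝ) (t : ℝ) :
    ((1 / (2 * Real.pi)) * ∫ θ in (0:ℝ)..(2 * Real.pi),
      Real.log (1 / δ ((t : ℂ) * Complex.exp (θ * Complex.I)))) =
    Real.circleAverage (fun z => Real.log (1 / δ z)) 0 t := by
  simp [Real.circleAverage_def, circleMap]

lemma avg_bound (h1 h2 h3 h4 h5 : ℂ → ℂ) (δ : ℂ → ℝ)
    (hδ : ∀ z, δ z = min 1 (min ‖h1 z‖ (min ‖h2 z‖ (min ‖h3 z‖ (min ‖h4 z‖ ‖h5 z‖)))))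
    (ρ : ℝ)
    (m1 : MeromorphicOn h1 (Metric.sphere 0 |ρ|)) (m2 : MeromorphicOn h2 (Metric.sphere 0 |ρ|))
    (m3 : MeromorphicOn h3 (Metric.sphere 0 |ρ|)) (m4 : MeromorphicOn h4 (Metric.sphere 0 |ρ|))
    (m5 : MeromorphicOn h5 (Metric.sphere 0 |ρ|)) :
    Real.circleAverage (fun z => Real.log (1 / δ z)) 0 ρ ≤
      circleAvg (fun w => (h1 w)⁻¹) ρ + circleAvg (fun w => (h2 w)⁻¹) ρ
      + circleAvg (fun w => (h3 w)⁻¹) ρ + circleAvg (fun w => (h4 w)⁻¹) ρ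
      + circleAvg (fun w => (h5 w)⁻¹) ρ := by
  have ci : ∀ (k : ℂ → ℂ), MeromorphicOn k (Metric.sphere 0 |ρ|) →
      CircleIntegrable (fun z => Real.posLog ‖(k z)⁻¹‖) 0 ρ := fun k hk =>
    hk.inv.circleIntegrable_posLog_norm
  have c1 := ci h1 m1
  have c2 := ci h2 m2
  have c3 := ci h3 m3
  have c4 := ci h4 m4
  have c5 := ci h5 m5
  have s2 : CircleIntegrable (fun z => Real.posLog ‖(h1 z)⁻¹‖ + Real.posLog ‖(h2 z)⁻¹‖) 0 ρ :=
    c1.add c2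
  have s3 : CircleIntegrable (fun z => Real.posLog ‖(h1 z)⁻¹‖ + Real.posLog ‖(h2 z)⁻¹‖
    + Real.posLog ‖(h3 z)⁻¹‖) 0 ρ := s2.add c3
  have s4 : CircleIntegrable (fun z => Real.posLog ‖(h1 z)⁻¹‖ + Real.posLog ‖(h2 z)⁻¹‖
    + Real.posLog ‖(h3 z)⁻¹‖ + Real.posLog ‖(h4 z)⁻¹‖) 0 ρ := s3.add c4
  have s5 : CircleIntegrable (fun z => Real.posLog ‖(h1 z)⁻¹‖ + Real.posLog ‖(h2 z)⁻¹‖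
    + Real.posLog ‖(h3 z)⁻¹‖ + Real.posLog ‖(h4 z)⁻¹‖ + Real.posLog ‖(h5 z)⁻¹‖) 0 ρ := s4.add c5
  simp only [circleAvg_eq]
  rw [← Real.circleAverage_fun_add c1 c2, ← Real.circleAverage_fun_add s2 c3,
    ← Real.circleAverage_fun_add s3 c4, ← Real.circleAverage_fun_add s4 c5]
  rw [Real.circleAverage_def, Real.circleAverage_def, smul_eq_mul, smul_eq_mul]
  refine mul_le_mul_of_nonneg_left ?_ (by positivity)
  have hp : (0:ℝ) ≤ 2 * Real.pi := by positivity
  rw [intervalIntegral.integral_of_le hp, intervalIntegral.integral_of_le hp]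
  refine MeasureTheory.integral_mono_of_nonneg (Filter.Eventually.of_forall fun θ => ?_)
    ((intervalIntegrable_iff_integrableOn_Ioc_of_le hp).1 s5)
    (Filter.Eventually.of_forall fun θ => ?_)
  · have d1 : δ (circleMap 0 ρ θ) ≤ 1 := by rw [hδ]; exact min_le_left _ _
    have d0 : 0 ≤ δ (circleMap 0 ρ θ) := by rw [hδ]; positivity
    change 0 ≤ Real.log (1 / δ (circleMap 0 ρ θ))
    rw [one_div, Real.log_inv]
    linarith [Real.log_nonpos d0 d1]
  · change Real.log (1 / δ (circleMap 0 ρ θ)) ≤ _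
    simp only [norm_inv]
    rw [hδ]
    exact delta_pointwise _ _ _ _ _

lemma deg_case (R0 : ℝ≥0∞) (b1 b2 h : ℂ → ℂ) (δ : ℂ → ℝ) (hδ : ∀ z, h z = 0 → δ z = 0)
    (ho : ∀ z ∈ Annulus R0, meromorphicOrderAt h z = ⊤) :
    ∃ C : ℝ, ∀ r : ℝ, 1 ≤ r → ENNReal.ofReal r < R0 →
      Real.circleAverage (fun z => Real.log (1 / δ z)) 0 r
        + Real.circleAverage (fun z => Real.log (1 / δ z)) 0 (1/r) ≤
        3 * T0 b1 r + 3 * T0 b2 r + (0 + 0) + C := by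
  refine ⟨6 * circleAvg b1 1 + 6 * circleAvg b2 1, fun r hr hR => ?_⟩
  have h0 : 0 < r := by linarith
  have h1r : 1 / r ≤ r := by rw [div_le_iff₀ h0]; nlinarith
  have hs := cAnn_sub R0 r hr hR
  rw [degenerate h δ hδ r h0.ne' fun z hz => ho z (hs (sphere_sub_s16 hr h1r le_rfl hz)),
    degenerate h δ hδ (1/r) (by positivity) fun z hz => ho z (hs (sphere_sub_s16 hr le_rfl h1r hz))]
  linarith [T0_lower b1 r hr, T0_lower b2 r hr]

/-- **Estimate for the auxiliary gauge function `δ`** (inequality (3.16)): with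
`δ(z) = min {1, |b₁(z)|, |b₂(z)|, |b₁(z)-1|, |b₂(z)-1|, |b₁(z)-b₂(z)|}` one has
`∑_{t=1/r,r} (1/2π) ∫₀^{2π} log (1/δ(t e^{iθ})) dθ
  ≤ 3 T₀(r,b₁) + 3 T₀(r,b₂) + S(r) + O(1)` for `1 ≤ r < R₀`. -/
theorem gauge_function_estimate
    (R0 : ℝ≥0∞) (hR0 : 1 < R0) (lam : ℝ) (hlam : 0 ≤ lam)
    (b1 b2 : ℂ → ℂ)
    (hb1 : MeromorphicOn b1 (Annulus R0)) (hb2 : MeromorphicOn b2 (Annulus R0))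
    (hb12 : ¬ Set.EqOn b1 b2 (Annulus R0))
    (hb10 : ¬ Set.EqOn b1 (fun _ => (0 : ℂ)) (Annulus R0))
    (hb11 : ¬ Set.EqOn b1 (fun _ => (1 : ℂ)) (Annulus R0))
    (hb20 : ¬ Set.EqOn b2 (fun _ => (0 : ℂ)) (Annulus R0))
    (hb21 : ¬ Set.EqOn b2 (fun _ => (1 : ℂ)) (Annulus R0))
    (δ : ℂ → ℝ)
    (hδ : δ = fun z => min 1 (min ‖b1 z‖ (min ‖b2 z‖
      (min ‖b1 z - 1‖ (min ‖b2 z - 1‖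
        ‖b1 z - b2 z‖))))) :
    ∃ S1 S2 : ℝ → ℝ, IsSmallTerm R0 lam b1 S1 ∧ IsSmallTerm R0 lam b2 S2 ∧
      ∃ C : ℝ, ∀ r : ℝ, 1 ≤ r → ENNReal.ofReal r < R0 →
        ((1 / (2 * Real.pi)) * ∫ θ in (0:ℝ)..(2 * Real.pi),
            Real.log (1 / δ ((r : ℂ) * Complex.exp (θ * Complex.I))))
          + ((1 / (2 * Real.pi)) * ∫ θ in (0:ℝ)..(2 * Real.pi),
            Real.log (1 / δ (((1/r : ℝ) : ℂ) * Complex.exp (θ * Complex.I)))) ≤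
          3 * T0 b1 r + 3 * T0 b2 r + (S1 r + S2 r) + C := by
  refine ⟨fun _ => 0, fun _ => 0, isSmall_zero _ _ _, isSmall_zero _ _ _, ?_⟩
  simp only [avg_form]
  have nn : ∀ z, 0 ≤ δ z := by intro z; rw [hδ]; positivity
  have l1 : ∀ z, δ z ≤ ‖b1 z‖ := fun z => by rw [hδ]; simp
  have l2 : ∀ z, δ z ≤ ‖b2 z‖ := fun z => by rw [hδ]; simp
  have l3 : ∀ z, δ z ≤ ‖b1 z - 1‖ := fun z => by rw [hδ]; simp
  have l4 : ∀ z, δ z ≤ ‖b2 z - 1‖ := fun z => by rw [hδ]; simp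
  have l5 : ∀ z, δ z ≤ ‖b1 z - b2 z‖ := fun z => by rw [hδ]; simp
  have k0 : MeromorphicOn (fun _ : ℂ => (0:ℂ)) (Annulus R0) := fun z _ => MeromorphicAt.const 0 z
  have k1 : MeromorphicOn (fun _ : ℂ => (1:ℂ)) (Annulus R0) := fun z _ => MeromorphicAt.const 1 z
  have m1 : MeromorphicOn (fun w => b1 w - 0) (Annulus R0) := hb1.sub k0
  have m2 : MeromorphicOn (fun w => b2 w - 0) (Annulus R0) := hb2.sub k0
  have m3 : MeromorphicOn (fun w => b1 w - 1) (Annulus R0) := hb1.sub k1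
  have m4 : MeromorphicOn (fun w => b2 w - 1) (Annulus R0) := hb2.sub k1
  have m5 : MeromorphicOn (fun w => b1 w - b2 w) (Annulus R0) := hb1.sub hb2
  have dz : ∀ (h : ℂ → ℂ), (∀ z, δ z ≤ ‖h z‖) → ∀ z, h z = 0 → δ z = 0 := by
    intro h hl z hz
    have := hl z
    rw [hz, norm_zero] at this
    exact le_antisymm this (nn z)
  rcases order_dichotomy R0 _ m1 with o1 | o1
  swap
  · exact deg_case R0 b1 b2 _ δ (dz _ (by simpa using l1)) o1
  rcases order_dichotomy R0 _ m2 with o2 | o2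
  swap
  · exact deg_case R0 b1 b2 _ δ (dz _ (by simpa using l2)) o2
  rcases order_dichotomy R0 _ m3 with o3 | o3
  swap
  · exact deg_case R0 b1 b2 _ δ (dz _ l3) o3
  rcases order_dichotomy R0 _ m4 with o4 | o4
  swap
  · exact deg_case R0 b1 b2 _ δ (dz _ l4) o4
  rcases order_dichotomy R0 _ m5 with o5 | o5
  swap
  · exact deg_case R0 b1 b2 _ δ (dz _ l5) o5
  let K : (ℂ → ℂ) → (ℂ → ℂ) → ℝ := fun f g =>
    2 * circleAvg f 1 + 2 * circleAvg g 1 + 2 * Real.log 2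
        - 2 * circleAvg (fun w => f w - g w) 1 + 2 * circleAvg (fun w => (f w - g w)⁻¹) 1
  refine ⟨K b1 (fun _ => 0) + K b2 (fun _ => 0) + K b1 (fun _ => 1) + K b2 (fun _ => 1)
    + K b1 b2, fun r hr hR => ?_⟩
  have h0 : 0 < r := by linarith
  have h1r : 1 / r ≤ r := by rw [div_le_iff₀ h0]; nlinarith
  have hs := cAnn_sub R0 r hr hR
  have P1 := prox_bound b1 (fun _ => 0) r hr (hb1.mono_set hs) (k0.mono_set hs)
    (fun z hz => o1 z (hs hz))
  have P2 := prox_bound b2 (fun _ => 0) r hr (hb2.mono_set hs) (k0.mono_set hs)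
    (fun z hz => o2 z (hs hz))
  have P3 := prox_bound b1 (fun _ => 1) r hr (hb1.mono_set hs) (k1.mono_set hs)
    (fun z hz => o3 z (hs hz))
  have P4 := prox_bound b2 (fun _ => 1) r hr (hb2.mono_set hs) (k1.mono_set hs)
    (fun z hz => o4 z (hs hz))
  have P5 := prox_bound b1 b2 r hr (hb1.mono_set hs) (hb2.mono_set hs)
    (fun z hz => o5 z (hs hz))
  rw [T0_const 0 (by simp) r hr] at P1 P2
  rw [T0_const 1 (by simp) r hr] at P3 P4
  have B : ∀ ρ : ℝ, 1 / r ≤ ρ → ρ ≤ r → _ := fun ρ q1 q2 =>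
    avg_bound (fun w => b1 w - 0) (fun w => b2 w - 0) (fun w => b1 w - 1) (fun w => b2 w - 1)
      (fun w => b1 w - b2 w) δ (fun z => by rw [hδ]; simp) ρ
      (m1.mono_set ((sphere_sub_s16 hr q1 q2).trans hs)) (m2.mono_set ((sphere_sub_s16 hr q1 q2).trans hs))
      (m3.mono_set ((sphere_sub_s16 hr q1 q2).trans hs)) (m4.mono_set ((sphere_sub_s16 hr q1 q2).trans hs))
      (m5.mono_set ((sphere_sub_s16 hr q1 q2).trans hs))
  have B1 := B r h1r le_rfl
  have B2 := B (1/r) le_rfl h1r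
  simp only [K]
  linarith

end
end
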